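/- arXiv:1506.04565 — 4 statements merged into one kernel-verified Lean document; each statement's English description precedes it below -/
import Mathlib

section
/- Let μ be a Borel probability measure on ℝ^d, absolutely continuous with respect to Lebesgue measure, that is not concentrated on any set of cardinality at most N − 1, and let c(x₁,…,x_N) = Σ_{1 ≤ i < j ≤ N} 1/|x_i − x_j| be the Coulomb cost. Then the minimum of ∫ c dγ over γ ∈ Π_N(μ) equals the maximum of N ∫_{ℝ^d} u(x) dμ(x) over all u ∈ L¹(ℝ^d, μ) satisfying Σ_{i=1}^N u(x_i) ≤ c(x₁,…,x_N) for μ^{⊗N}-almost every (x₁,…,x_N); moreover the dual maximum is attained by a bounded function u. -/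
open MeasureTheory ENNReal

/-- The Coulomb cost on `(ℝ^d)^N`, with value `+∞` on the diagonals. -/
noncomputable def coulomb {d N : ℕ} (x : Fin N → EuclideanSpace ℝ (Fin d)) : ℝ≥0∞ :=
  ∑ i : Fin N, ∑ j ∈ Finset.Ioi i, (ENNReal.ofReal ‖x i - x j‖)⁻¹


namespace DePascale

open Filter Topology

theorem continuous_coulomb {d N : ℕ} :
    Continuous (coulomb : (Fin N → EuclideanSpace ℝ (Fin d)) → ℝ≥0∞) := by
  unfold coulomb
  refine continuous_finsetSum _ fun i _ => continuous_finsetSum _ fun j _ => ?_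
  refine continuous_inv.comp (ENNReal.continuous_ofReal.comp ?_)
  fun_prop

theorem coulomb_two {d N : ℕ} (x : Fin N → EuclideanSpace ℝ (Fin d)) :
    2 * coulomb x = ∑ i, ∑ j ∈ Finset.univ.filter (fun j => i ≠ j),
      (ENNReal.ofReal ‖x i - x j‖)⁻¹ := by
  have h1 : coulomb x = ∑ i, ∑ j, if i < j then (ENNReal.ofReal ‖x i - x j‖)⁻¹ else 0 := by
    unfold coulomb
    refine Finset.sum_congr rfl fun i _ => ?_
    rw [← Finset.sum_filter]
    refine Finset.sum_congr ?_ fun _ _ => rfl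
    ext j; simp
  have h2 : coulomb x = ∑ i, ∑ j, if j < i then (ENNReal.ofReal ‖x i - x j‖)⁻¹ else 0 := by
    rw [h1, Finset.sum_comm]
    refine Finset.sum_congr rfl fun i _ => Finset.sum_congr rfl fun j _ => ?_
    rw [norm_sub_rev]
  rw [two_mul]
  conv_lhs => rw [h1]
  nth_rewrite 2 [← h1]
  rw [h2, ← Finset.sum_add_distrib]
  refine Finset.sum_congr rfl fun i _ => ?_
  rw [← Finset.sum_add_distrib, Finset.sum_filter]
  refine Finset.sum_congr rfl fun j _ => ?_
  rcases lt_trichotomy i j with h | h | h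
  · simp [h, h.ne, h.not_gt]
  · simp [h]
  · simp [h, h.ne', h.not_gt]

theorem coulomb_perm {d N : ℕ} (x : Fin N → EuclideanSpace ℝ (Fin d)) (σ : Equiv.Perm (Fin N)) :
    coulomb (fun i => x (σ i)) = coulomb x := by
  have h : 2 * coulomb (fun i => x (σ i)) = 2 * coulomb x := by
    rw [coulomb_two, coulomb_two]
    simp only [Finset.sum_filter]
    rw [← Equiv.sum_comp σ (fun i => ∑ j, if i ≠ j then (ENNReal.ofReal ‖x i - x j‖)⁻¹ else 0)]
    refine Finset.sum_congr rfl fun i _ => ?_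
    rw [← Equiv.sum_comp σ (fun j => if σ i ≠ j then (ENNReal.ofReal ‖x (σ i) - x j‖)⁻¹ else 0)]
    refine Finset.sum_congr rfl fun j _ => ?_
    simp
  exact (ENNReal.mul_right_inj (by norm_num) (by norm_num)).1 h

theorem ofReal_le_iff (a : ℝ) (c : ℝ≥0∞) : ENNReal.ofReal a ≤ c ↔ (c ≠ ∞ → a ≤ c.toReal) := by
  constructor
  · intro h hc
    exact (ENNReal.ofReal_le_iff_le_toReal hc).1 h
  · intro h
    by_cases hc : c = ∞
    · simp [hc]
    · exact (ENNReal.ofReal_le_iff_le_toReal hc).2 (h hc)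

theorem average_pi {d N : ℕ} (μ : Measure (EuclideanSpace ℝ (Fin d))) [IsProbabilityMeasure μ]
    (v : EuclideanSpace ℝ (Fin d) → ℝ) (hv : Integrable v μ)
    (B : Fin N → Set (EuclideanSpace ℝ (Fin d))) (hB : ∀ i, 0 < μ (B i)) (i : Fin N) :
    Integrable (fun y : Fin N → EuclideanSpace ℝ (Fin d) => v (y i))
      (Measure.pi fun j => μ.restrict (B j)) ∧
    ∫ y, v (y i) ∂(Measure.pi fun j => μ.restrict (B j)) =
      (∏ j, μ.real (B j)) * ⨍ z in B i, v z ∂μ := by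
  have hmap := Measure.pi_map_eval (μ := fun j => μ.restrict (B j)) i
  have hmeas : Measurable (Function.eval i : (Fin N → EuclideanSpace ℝ (Fin d)) → _) :=
    measurable_pi_apply i
  have hvi : Integrable v ((∏ j ∈ Finset.univ.erase i, (μ.restrict (B j)) Set.univ) •
      μ.restrict (B i)) := by
    refine (hv.restrict).smul_measure ?_
    refine (ENNReal.prod_lt_top fun j _ => ?_).ne
    exact measure_lt_top _ _
  rw [← hmap] at hvi
  constructor
  · exact (integrable_map_measure hvi.1 hmeas.aemeasurable).1 hvi
  · have := integral_map hmeas.aemeasurable hvi.1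
    simp only [Function.eval] at this
    rw [← this]
    change ∫ y, v y ∂((Measure.pi fun j => μ.restrict (B j)).map (Function.eval i)) = _
    rw [hmap, integral_smul_measure, setAverage_eq]
    have hp : 0 < μ.real (B i) := ENNReal.toReal_pos (hB i).ne' (measure_ne_top _ _)
    rw [ENNReal.toReal_prod, ← Finset.mul_prod_erase Finset.univ _ (Finset.mem_univ i)]
    simp only [Measure.restrict_apply_univ, smul_eq_mul, Measure.real] at hp ⊢
    field_simp

theorem weak_duality {d N : ℕ} (μ : Measure (EuclideanSpace ℝ (Fin d))) [IsProbabilityMeasure μ]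
    (v : EuclideanSpace ℝ (Fin d) → ℝ) (hv : Integrable v μ)
    (hf : ∀ᵐ x ∂(Measure.pi fun _ : Fin N => μ), ENNReal.ofReal (∑ i, v (x i)) ≤ coulomb x)
    (γ : Measure (Fin N → EuclideanSpace ℝ (Fin d)))
    (hγ : ∀ i, γ.map (fun x => x i) = μ) :
    ENNReal.ofReal ((N : ℝ) * ∫ x, v x ∂μ) ≤ ∫⁻ x, coulomb x ∂γ := by
  have hgood : ∀ᵐ x ∂μ, Tendsto (fun r => ⨍ y in Metric.closedBall x r, v y ∂μ) (𝓝[>] 0) (𝓝 (v x))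
      ∧ ∀ᶠ r in 𝓝[>] (0:ℝ), 0 < μ (Metric.closedBall x r) := by
    filter_upwards [(Besicovitch.vitaliFamily μ).ae_tendsto_average hv.locallyIntegrable,
      (Besicovitch.vitaliFamily μ).ae_eventually_measure_pos] with x h1 h2
    exact ⟨h1.comp (Besicovitch.tendsto_filterAt μ x), (Besicovitch.tendsto_filterAt μ x).eventually h2⟩
  have key : ∀ x : Fin N → EuclideanSpace ℝ (Fin d),
      (∀ i, Tendsto (fun r => ⨍ y in Metric.closedBall (x i) r, v y ∂μ) (𝓝[>] 0) (𝓝 (v (x i)))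
      ∧ ∀ᶠ r in 𝓝[>] (0:ℝ), 0 < μ (Metric.closedBall (x i) r)) →
      ENNReal.ofReal (∑ i, v (x i)) ≤ coulomb x := by
    intro x hx
    rw [ofReal_le_iff]
    intro hc
    refine le_of_forall_pos_le_add fun ε hε => ?_
    have hlim : Tendsto (fun r => ∑ i, ⨍ y in Metric.closedBall (x i) r, v y ∂μ) (𝓝[>] 0)
        (𝓝 (∑ i, v (x i))) := tendsto_finsetSum _ fun i _ => (hx i).1
    refine le_of_tendsto hlim ?_
    have hlt : coulomb x < ENNReal.ofReal ((coulomb x).toReal + ε) := by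
      rw [ENNReal.lt_ofReal_iff_toReal_lt hc]; linarith
    have hnear : ∀ᶠ y in 𝓝 x, coulomb y < ENNReal.ofReal ((coulomb x).toReal + ε) :=
      continuous_coulomb.continuousAt.eventually (gt_mem_nhds hlt)
    obtain ⟨δ, hδ, hball⟩ := Metric.eventually_nhds_iff.1 hnear
    have hpos : ∀ᶠ r in 𝓝[>] (0:ℝ), ∀ i, 0 < μ (Metric.closedBall (x i) r) :=
      eventually_all.2 fun i => (hx i).2
    filter_upwards [hpos, Ioo_mem_nhdsGT hδ] with r hr hrδ
    set ρ := Measure.pi fun j => μ.restrict (Metric.closedBall (x j) r) with hρ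
    have hρ' : (Measure.pi fun _ : Fin N => μ).restrict
        (Set.univ.pi fun i => Metric.closedBall (x i) r) = ρ := Measure.restrict_pi_pi _ _
    have hae : ∀ᵐ y ∂ρ, ∑ i, v (y i) ≤ (coulomb x).toReal + ε := by
      rw [← hρ']
      filter_upwards [ae_restrict_of_ae hf, ae_restrict_mem
        (MeasurableSet.univ_pi fun i => Metric.isClosed_closedBall.measurableSet)] with y hy1 hy2
      have : dist y x < δ := by
        refine lt_of_le_of_lt ((dist_pi_le_iff hrδ.1.le).2 fun i => ?_) hrδ.2
        exact hy2 i (Set.mem_univ _)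
      have h3 := hy1.trans_lt (hball this)
      exact ((ENNReal.ofReal_lt_ofReal_iff (by positivity)).1 h3).le
    have hIntg : ∀ i, _ := fun i =>
      average_pi μ v hv (fun j => Metric.closedBall (x j) r) hr i
    have h4 : ∫ y, ∑ i, v (y i) ∂ρ ≤ ∫ y, ((coulomb x).toReal + ε) ∂ρ :=
      integral_mono_ae (integrable_finsetSum _ fun i _ => (hIntg i).1) (integrable_const _) hae
    rw [integral_finsetSum _ fun i _ => (hIntg i).1] at h4
    simp only [fun i => (hIntg i).2] at h4
    rw [← Finset.mul_sum, integral_const, smul_eq_mul] at h4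
    have huniv : ρ.real Set.univ = ∏ j, μ.real (Metric.closedBall (x j) r) := by
      simp [hρ, Measure.real, Measure.pi_univ, ENNReal.toReal_prod]
    rw [huniv] at h4
    refine le_of_mul_le_mul_left h4 (Finset.prod_pos fun j _ => ?_)
    exact ENNReal.toReal_pos (hr j).ne' (measure_ne_top _ _)
  have hae : ∀ᵐ x ∂γ, ENNReal.ofReal (∑ i, v (x i)) ≤ coulomb x := by
    have : ∀ᵐ x ∂γ, ∀ i, _ := ae_all_iff.2 fun i => by
      have h := hgood
      rw [← hγ i] at h
      have := ae_of_ae_map (measurable_pi_apply i).aemeasurable h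
      rw [hγ i] at this
      exact this
    filter_upwards [this] with x hx using key x hx
  have hi : ∀ i, Integrable (fun x : Fin N → EuclideanSpace ℝ (Fin d) => v (x i)) γ := by
    intro i
    have h := hv
    rw [← hγ i] at h
    exact (integrable_map_measure h.1 (measurable_pi_apply i).aemeasurable).1 h
  have hIntg : ∫ x, ∑ i, v (x i) ∂γ = N * ∫ x, v x ∂μ := by
    rw [integral_finsetSum _ fun i _ => hi i]
    have : ∀ i : Fin N, ∫ x, v (x i) ∂γ = ∫ x, v x ∂μ := by
      intro i
      have h := hv.1
      rw [← hγ i] at h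
      have h2 := integral_map (φ := fun x : Fin N → EuclideanSpace ℝ (Fin d) => x i)
        (measurable_pi_apply i).aemeasurable h
      rw [hγ i] at h2
      exact h2.symm
    simp [this]
  rw [← hIntg]
  refine le_trans ?_ (lintegral_mono_ae hae)
  have hI : Integrable (fun x : Fin N → EuclideanSpace ℝ (Fin d) => ∑ i, v (x i)) γ :=
    integrable_finsetSum _ fun i _ => hi i
  rw [integral_eq_lintegral_pos_part_sub_lintegral_neg_part hI]
  refine (ENNReal.ofReal_le_ofReal (sub_le_self _ ENNReal.toReal_nonneg)).trans ?_
  exact ENNReal.ofReal_toReal_le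

theorem small_balls {d : ℕ} (hd : d ≠ 0) (μ : Measure (EuclideanSpace ℝ (Fin d)))
    [IsProbabilityMeasure μ] (hac : μ ≪ volume) (ε : ℝ≥0∞) (hε : ε ≠ 0) :
    ∃ r : ℝ, 0 < r ∧ ∀ x, μ (Metric.closedBall x r) ≤ ε := by
  have hw : volume.withDensity (μ.rnDeriv volume) = μ := Measure.withDensity_rnDeriv_eq _ _ hac
  have hfin : ∫⁻ x, μ.rnDeriv volume x ≠ ∞ := (Measure.lintegral_rnDeriv_lt_top μ volume).ne
  obtain ⟨δ, hδ, h⟩ := exists_pos_setLIntegral_lt_of_measure_lt hfin hε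
  have ht : Tendsto (fun r : ℝ => ENNReal.ofReal (r ^ Module.finrank ℝ (EuclideanSpace ℝ (Fin d))) *
      volume (Metric.ball (0 : EuclideanSpace ℝ (Fin d)) 1)) (𝓝[>] 0) (𝓝 0) := by
    have h1 : Tendsto (fun r : ℝ => ENNReal.ofReal (r ^ Module.finrank ℝ (EuclideanSpace ℝ (Fin d))))
        (𝓝[>] 0) (𝓝 0) := by
      have : Continuous (fun r : ℝ =>
        ENNReal.ofReal (r ^ Module.finrank ℝ (EuclideanSpace ℝ (Fin d)))) :=
        ENNReal.continuous_ofReal.comp (by fun_prop)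
      have h2 := (this.tendsto 0).mono_left (nhdsWithin_le_nhds (s := Set.Ioi 0))
      simpa [hd] using h2
    have h3 := ENNReal.Tendsto.mul_const h1
      (b := volume (Metric.ball (0 : EuclideanSpace ℝ (Fin d)) 1))
      (Or.inr Metric.isBounded_ball.measure_lt_top.ne)
    simpa using h3
  obtain ⟨r, hr1, hr2⟩ := ((ht.eventually (gt_mem_nhds hδ)).and self_mem_nhdsWithin).exists
  refine ⟨r, hr2, fun x => ?_⟩
  have := h (Metric.closedBall x r) (by
    rw [Measure.addHaar_closedBall _ _ (le_of_lt hr2)]; exact hr1)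
  rw [← withDensity_apply _ Metric.isClosed_closedBall.measurableSet, hw] at this
  exact this.le

theorem coulomb_le {d N : ℕ} (z : Fin N → EuclideanSpace ℝ (Fin d)) (r : ℝ) (hr : 0 < r)
    (h : ∀ i j, i ≠ j → r < dist (z i) (z j)) : coulomb z ≤ ENNReal.ofReal (N * (N * r⁻¹)) := by
  have h1 : ∀ i j : Fin N, i ≠ j → (ENNReal.ofReal ‖z i - z j‖)⁻¹ ≤ ENNReal.ofReal r⁻¹ := by
    intro i j hij
    rw [ENNReal.ofReal_inv_of_pos hr]
    refine ENNReal.inv_le_inv.2 (ENNReal.ofReal_le_ofReal ?_)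
    rw [← dist_eq_norm]
    exact (h i j hij).le
  unfold coulomb
  calc _ ≤ ∑ i : Fin N, ∑ j ∈ Finset.Ioi i, ENNReal.ofReal r⁻¹ :=
        Finset.sum_le_sum fun i _ => Finset.sum_le_sum fun j hj =>
          h1 i j (Finset.mem_Ioi.1 hj).ne
    _ ≤ ∑ i : Fin N, ∑ j : Fin N, ENNReal.ofReal r⁻¹ :=
        Finset.sum_le_sum fun i _ => Finset.sum_le_sum_of_subset (Finset.subset_univ _)
    _ = _ := by
        simp only [Finset.sum_const, Finset.card_univ, Fintype.card_fin, nsmul_eq_mul]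
        rw [ENNReal.ofReal_mul (by positivity), ENNReal.ofReal_mul (by positivity)]
        simp

theorem pair_measure {d N : ℕ} (μ : Measure (EuclideanSpace ℝ (Fin d))) [IsProbabilityMeasure μ]
    (r : ℝ) (ε : ℝ≥0∞) (hb : ∀ x, μ (Metric.closedBall x r) ≤ ε) (i j : Fin N) (hij : i ≠ j) :
    (Measure.pi fun _ : Fin N => μ) {y | dist (y i) (y j) ≤ r} ≤ ε := by
  have hind := (ProbabilityTheory.iIndepFun_pi (μ := fun _ : Fin N => μ)
    (X := fun _ => id) (fun _ => aemeasurable_id)).indepFun hij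
  have hmi : ∀ i : Fin N, Measurable fun y : Fin N → EuclideanSpace ℝ (Fin d) => y i :=
    fun i => measurable_pi_apply i
  have hm := (ProbabilityTheory.indepFun_iff_map_prod_eq_prod_map_map
    (hmi i).aemeasurable (hmi j).aemeasurable).1 hind
  have he : ∀ i : Fin N, (Measure.pi fun _ : Fin N => μ).map (fun y => y i) = μ :=
    fun i => (measurePreserving_eval (fun _ : Fin N => μ) i).map_eq
  rw [he i, he j] at hm
  have hs : MeasurableSet {p : EuclideanSpace ℝ (Fin d) × EuclideanSpace ℝ (Fin d) |
      dist p.1 p.2 ≤ r} := (isClosed_le (by fun_prop) (by fun_prop)).measurableSet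
  have h1 : (Measure.pi fun _ : Fin N => μ) {y | dist (y i) (y j) ≤ r} =
      (μ.prod μ) {p | dist p.1 p.2 ≤ r} := by
    rw [← hm, Measure.map_apply ((hmi i).prodMk (hmi j)) hs]
    rfl
  rw [h1, Measure.prod_apply hs]
  calc _ ≤ ∫⁻ x, ε ∂μ := by
        refine lintegral_mono fun x => ?_
        refine le_trans (measure_mono ?_) (hb x)
        intro y hy
        simpa [dist_comm] using hy
    _ = ε := by simp

/-- uniform upper bound on admissible potentials of nonnegative mean. -/
theorem apriori {d N : ℕ} (hN : 2 ≤ N) (μ : Measure (EuclideanSpace ℝ (Fin d)))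
    [IsProbabilityMeasure μ] (r : ℝ) (hr : 0 < r)
    (hb : ∀ x, μ (Metric.closedBall x r) ≤ ENNReal.ofReal (1 / (2 * N ^ 3)))
    (u : EuclideanSpace ℝ (Fin d) → ℝ) (hu : Measurable u) (B : ℝ) (hB : ∀ x, |u x| ≤ B)
    (hf : ∀ x : Fin N → EuclideanSpace ℝ (Fin d),
      ENNReal.ofReal (∑ i, u (x i)) ≤ coulomb x) (h0 : 0 ≤ ∫ x, u x ∂μ) (x : EuclideanSpace ℝ (Fin d)) :
    u x ≤ 2 * (N * (N * r⁻¹)) := by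
  set C : ℝ := N * (N * r⁻¹) with hC
  have hC0 : 0 ≤ C := by positivity
  have hNpos : (0 : ℝ) < N := by exact_mod_cast (by omega : 0 < N)
  let i0 : Fin N := ⟨0, by omega⟩
  have main : ∀ S : ℝ, 0 ≤ S → (∀ x, u x ≤ S) → ∀ x, u x ≤ C + S / 2 := by
    intro S hS huS x
    let z : (Fin N → EuclideanSpace ℝ (Fin d)) → Fin N → EuclideanSpace ℝ (Fin d) :=
      fun y => Function.update y i0 x
    have hz : Continuous z := by fun_prop
    let F : Fin N → Fin N → Set (Fin N → EuclideanSpace ℝ (Fin d)) :=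
      fun i j => if i ≠ j then {y | dist (z y i) (z y j) ≤ r} else ∅
    have hFm : ∀ i j, MeasurableSet (F i j) := by
      intro i j
      by_cases hij : i = j
      · simp [F, hij]
      · simp only [F, ne_eq, hij, not_false_eq_true, if_true]
        exact (isClosed_le (by fun_prop) (by fun_prop)).measurableSet
    let H := ⋃ i, ⋃ j, F i j
    have hHm : MeasurableSet H := .iUnion fun i => .iUnion fun j => hFm i j
    set P := Measure.pi fun _ : Fin N => μ with hP
    have hF : ∀ i j, P (F i j) ≤ ENNReal.ofReal (1 / (2 * N ^ 3)) := by
      intro i j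
      by_cases hij : i = j
      · simp [F, hij]
      simp only [F, ne_eq, hij, not_false_eq_true, if_true]
      have hone : ∀ k : Fin N, P {y | dist (y k) x ≤ r} ≤ ENNReal.ofReal (1 / (2 * N ^ 3)) := by
        intro k
        refine le_trans (le_of_eq ?_) (hb x)
        exact (measurePreserving_eval (fun _ : Fin N => μ) k).measure_preimage
          Metric.isClosed_closedBall.measurableSet.nullMeasurableSet
      by_cases hi : i = i0
      · subst hi
        have : ∀ y, z y j = y j := fun y => Function.update_of_ne (Ne.symm hij) _ _
        have h2 : ∀ y, z y i0 = x := fun y => Function.update_self _ _ _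
        simp only [this, h2]
        simpa [dist_comm] using hone j
      · have h1 : ∀ y, z y i = y i := fun y => Function.update_of_ne hi _ _
        by_cases hj : j = i0
        · subst hj
          have h2 : ∀ y, z y i0 = x := fun y => Function.update_self _ _ _
          simp only [h1, h2]
          exact hone i
        · have h2 : ∀ y, z y j = y j := fun y => Function.update_of_ne hj _ _
          simp only [h1, h2]
          exact pair_measure μ r _ hb i j hij
    have hH : P.real H ≤ 1 / (2 * N) := by
      have : P H ≤ ENNReal.ofReal (1 / (2 * N)) := by
        calc P H ≤ ∑ i, ∑ j, P (F i j) :=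
              (measure_iUnion_fintype_le _ _).trans
                (Finset.sum_le_sum fun i _ => measure_iUnion_fintype_le _ _)
          _ ≤ ∑ i : Fin N, ∑ j : Fin N, ENNReal.ofReal (1 / (2 * N ^ 3)) :=
              Finset.sum_le_sum fun i _ => Finset.sum_le_sum fun j _ => hF i j
          _ = ENNReal.ofReal (N * (N * (1 / (2 * N ^ 3)))) := by
              simp only [Finset.sum_const, Finset.card_univ, Fintype.card_fin, nsmul_eq_mul]
              rw [ENNReal.ofReal_mul (by positivity), ENNReal.ofReal_mul (by positivity)]
              simp
          _ = _ := by
              congr 1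
              field_simp
      exact ENNReal.toReal_le_of_le_ofReal (by positivity) this
    have hpt : ∀ y, u x + ∑ i ∈ Finset.univ.erase i0, u (y i) ≤
        C + H.indicator (fun _ => N * S) y := by
      intro y
      have hsum : ∑ i, u (z y i) = u x + ∑ i ∈ Finset.univ.erase i0, u (y i) := by
        have e : u (z y i0) = u x := by simp [z]
        rw [← Finset.add_sum_erase Finset.univ _ (Finset.mem_univ i0), e]
        refine congrArg _ (Finset.sum_congr rfl fun i hi => ?_)
        rw [show z y i = y i from Function.update_of_ne (Finset.ne_of_mem_erase hi) _ _]
      rw [← hsum]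
      by_cases hy : y ∈ H
      · rw [Set.indicator_of_mem hy]
        have : ∑ i, u (z y i) ≤ ∑ i : Fin N, S := Finset.sum_le_sum fun i _ => huS _
        simp at this
        linarith
      · rw [Set.indicator_of_notMem hy, add_zero]
        have hsep : ∀ i j, i ≠ j → r < dist (z y i) (z y j) := by
          intro i j hij
          by_contra hcon
          apply hy
          refine Set.mem_iUnion.2 ⟨i, Set.mem_iUnion.2 ⟨j, ?_⟩⟩
          simp only [F, ne_eq, hij, not_false_eq_true, if_true]
          exact not_lt.1 hcon
        have := (hf (z y)).trans (coulomb_le (z y) r hr hsep)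
        exact (ENNReal.ofReal_le_ofReal_iff hC0).1 this
    have hui : ∀ i : Fin N, Integrable (fun y : Fin N → EuclideanSpace ℝ (Fin d) => u (y i)) P := by
      intro i
      refine Integrable.of_bound (hu.comp (measurable_pi_apply i)).aestronglyMeasurable B ?_
      exact ae_of_all _ fun y => hB _
    have huint : ∀ i : Fin N, ∫ y, u (y i) ∂P = ∫ x, u x ∂μ := by
      intro i
      have h := integral_map (μ := P) (φ := fun y : Fin N → EuclideanSpace ℝ (Fin d) => y i)
        (measurable_pi_apply i).aemeasurable (f := u) hu.aestronglyMeasurable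
      rw [← h]
      exact congrArg (fun m => ∫ x, u x ∂m)
        (measurePreserving_eval (fun _ : Fin N => μ) i).map_eq
    have hI := integral_mono
      (((integrable_const (u x)).add (integrable_finsetSum (Finset.univ.erase i0) fun i _ => hui i)))
      ((integrable_const C).add ((integrable_const (μ := P) ((N : ℝ) * S)).indicator hHm)) hpt
    simp only [Pi.add_apply] at hI
    rw [integral_add (integrable_const _) (integrable_finsetSum _ fun i _ => hui i),
      integral_add (integrable_const _) ((integrable_const _).indicator hHm),
      integral_finsetSum _ fun i _ => hui i, integral_indicator hHm] at hI
    simp only [huint] at hI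
    simp only [integral_const, probReal_univ, smul_eq_mul, one_mul, Finset.sum_const,
      nsmul_eq_mul, measureReal_restrict_apply_univ] at hI
    have h5 : 0 ≤ ((Finset.univ.erase i0).card : ℝ) * ∫ x, u x ∂μ := by positivity
    have h6 : P.real H * (N * S) ≤ 1 / (2 * N) * (N * S) := by gcongr
    have h7 : 1 / (2 * N) * (N * S) = S / 2 := by field_simp
    linarith
  have hbdd : BddAbove (Set.range u) := ⟨B, by rintro _ ⟨y, rfl⟩; exact (le_abs_self _).trans (hB y)⟩
  have hle : ∀ x, u x ≤ sSup (Set.range u) := fun x => le_csSup hbdd ⟨x, rfl⟩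
  by_cases hS : 0 ≤ sSup (Set.range u)
  · have := main _ hS hle
    have h2 : sSup (Set.range u) ≤ C + sSup (Set.range u) / 2 :=
      csSup_le ⟨u x, x, rfl⟩ (by rintro _ ⟨y, rfl⟩; exact this y)
    linarith [hle x]
  · linarith [hle x]

theorem hilbert_nested {E : Type*} [NormedAddCommGroup E] [InnerProductSpace ℝ E] [CompleteSpace E]
    (C : ℕ → Set E) (hanti : Antitone C) (hne : ∀ n, (C n).Nonempty) (hcl : ∀ n, IsClosed (C n))
    (hcv : ∀ n, Convex ℝ (C n)) (R : ℝ) (hR : ∀ x ∈ C 0, ‖x‖ ≤ R) : (⋂ n, C n).Nonempty := by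
  have hex : ∀ n, ∃ v ∈ C n, ∀ w ∈ C n, ‖v‖ ≤ ‖w‖ := by
    intro n
    obtain ⟨v, hv, h⟩ := exists_norm_eq_iInf_of_complete_convex (hne n) (hcl n).isComplete (hcv n) 0
    refine ⟨v, hv, fun w hw => ?_⟩
    simp only [zero_sub, norm_neg] at h
    rw [h]
    exact ciInf_le ⟨0, by rintro _ ⟨y, rfl⟩; exact norm_nonneg _⟩ (⟨w, hw⟩ : C n)
  choose v hvC hvmin using hex
  have hmono : Monotone fun n => ‖v n‖ ^ 2 := by
    intro n m hnm
    have := hvmin n (v m) (hanti hnm (hvC m))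
    dsimp only
    gcongr
  have hbd : BddAbove (Set.range fun n => ‖v n‖ ^ 2) := by
    refine ⟨R ^ 2, ?_⟩
    rintro _ ⟨n, rfl⟩
    have := hR (v n) (hanti (Nat.zero_le n) (hvC n))
    dsimp only
    gcongr
  have hconv := tendsto_atTop_ciSup hmono hbd
  have hest : ∀ n m, n ≤ m → ‖v n - v m‖ ^ 2 ≤ 2 * (‖v m‖ ^ 2 - ‖v n‖ ^ 2) := by
    intro n m hnm
    have hmid : (1/2 : ℝ) • v n + (1/2 : ℝ) • v m ∈ C n :=
      hcv n (hvC n) (hanti hnm (hvC m)) (by norm_num) (by norm_num) (by norm_num)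
    have h1 := hvmin n _ hmid
    rw [← smul_add, norm_smul] at h1
    have h2 := parallelogram_law_with_norm ℝ (v n) (v m)
    norm_num at h1
    have h3 : (2 * ‖v n‖) ^ 2 ≤ ‖v n + v m‖ ^ 2 := by
      gcongr
      linarith
    nlinarith
  have hcau : CauchySeq v := by
    rw [Metric.cauchySeq_iff']
    intro ε hε
    have hc := hconv.cauchySeq
    rw [Metric.cauchySeq_iff'] at hc
    obtain ⟨n0, hn0⟩ := hc (ε ^ 2 / 2) (by positivity)
    refine ⟨n0, fun n hn => ?_⟩
    have h1 := hn0 n hn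
    rw [Real.dist_eq] at h1
    have h2 := hest n0 n hn
    have h3 := le_abs_self (‖v n‖ ^ 2 - ‖v n0‖ ^ 2)
    rw [dist_comm, dist_eq_norm]
    refine lt_of_pow_lt_pow_left₀ 2 hε.le ?_
    linarith
  obtain ⟨a, ha⟩ := cauchySeq_tendsto_of_complete hcau
  refine ⟨a, Set.mem_iInter.2 fun n => ?_⟩
  refine (hcl n).mem_of_tendsto ha ?_
  filter_upwards [eventually_ge_atTop n] with m hm using hanti hm (hvC m)

theorem ae_pi_of_ae {d N : ℕ} (μ : Measure (EuclideanSpace ℝ (Fin d))) [IsProbabilityMeasure μ]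
    {p : EuclideanSpace ℝ (Fin d) → Prop} (h : ∀ᵐ x ∂μ, p x) :
    ∀ᵐ y ∂(Measure.pi fun _ : Fin N => μ), ∀ i, p (y i) :=
  ae_all_iff.2 fun i =>
    (measurePreserving_eval (fun _ : Fin N => μ) i).quasiMeasurePreserving.ae h

theorem exists_maximizer {d N : ℕ} (μ : Measure (EuclideanSpace ℝ (Fin d)))
    [IsProbabilityMeasure μ] (M : ℝ) (hM : 0 ≤ M) :
    ∃ u : EuclideanSpace ℝ (Fin d) → ℝ, Measurable u ∧ (∀ x, |u x| ≤ M) ∧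
      (∀ᵐ x ∂(Measure.pi fun _ : Fin N => μ), ENNReal.ofReal (∑ i, u (x i)) ≤ coulomb x) ∧
      ∀ w : EuclideanSpace ℝ (Fin d) → ℝ, Measurable w → (∀ x, |w x| ≤ M) →
      (∀ᵐ x ∂(Measure.pi fun _ : Fin N => μ), ENNReal.ofReal (∑ i, w (x i)) ≤ coulomb x) →
      ∫ x, w x ∂μ ≤ ∫ x, u x ∂μ := by
  let P := Measure.pi fun _ : Fin N => μ
  let A : Set (Lp ℝ 2 μ) := {f | (∀ᵐ x ∂μ, |f x| ≤ M) ∧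
    ∀ᵐ x ∂P, ENNReal.ofReal (∑ i, f (x i)) ≤ coulomb x}
  have hAcl : IsClosed A := by
    refine IsSeqClosed.isClosed fun f g hf hfg => ?_
    obtain ⟨ns, -, hns⟩ := (tendstoInMeasure_of_tendsto_Lp hfg).exists_seq_tendsto_ae
    constructor
    · have hall : ∀ᵐ x ∂μ, ∀ n, |f n x| ≤ M := ae_all_iff.2 fun n => (hf n).1
      filter_upwards [hns, hall] with x h1 h2
      exact le_of_tendsto h1.abs (Eventually.of_forall fun n => h2 _)
    · have hall : ∀ᵐ x ∂P, ∀ n, ENNReal.ofReal (∑ i, f n (x i)) ≤ coulomb x :=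
        ae_all_iff.2 fun n => (hf n).2
      filter_upwards [ae_pi_of_ae (N := N) μ hns, hall] with x h1 h2
      have h3 : Tendsto (fun k => ENNReal.ofReal (∑ i, f (ns k) (x i))) atTop
          (𝓝 (ENNReal.ofReal (∑ i, g (x i)))) :=
        ENNReal.tendsto_ofReal (tendsto_finsetSum _ fun i _ => h1 i)
      exact le_of_tendsto h3 (Eventually.of_forall fun n => h2 _)
  have hAcv : Convex ℝ A := by
    intro f hf g hg a b ha hb hab
    have hco : ∀ᵐ x ∂μ, (a • f + b • g : Lp ℝ 2 μ) x = a * f x + b * g x := by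
      filter_upwards [Lp.coeFn_add (a • f) (b • g), Lp.coeFn_smul a f, Lp.coeFn_smul b g]
        with x h1 h2 h3
      rw [h1, Pi.add_apply, h2, h3]; simp
    constructor
    · filter_upwards [hco, hf.1, hg.1] with x h1 h2 h3
      rw [h1]
      calc |a * f x + b * g x| ≤ |a * f x| + |b * g x| := abs_add_le _ _
        _ = a * |f x| + b * |g x| := by rw [abs_mul, abs_mul, abs_of_nonneg ha, abs_of_nonneg hb]
        _ ≤ a * M + b * M := by gcongr
        _ = M := by rw [← add_mul, hab, one_mul]
    · filter_upwards [ae_pi_of_ae (N := N) μ hco, hf.2, hg.2] with x h1 h2 h3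
      simp only [h1]
      rw [ofReal_le_iff] at *
      intro hc
      rw [Finset.sum_add_distrib, ← Finset.mul_sum, ← Finset.mul_sum]
      calc _ ≤ a * (coulomb x).toReal + b * (coulomb x).toReal := by
            gcongr
            · exact h2 hc
            · exact h3 hc
        _ = _ := by rw [← add_mul, hab, one_mul]
  let one : Lp ℝ 2 μ := indicatorConstLp 2 MeasurableSet.univ (measure_ne_top μ _) (1 : ℝ)
  have hIntg : ∀ f : Lp ℝ 2 μ, inner ℝ one f = ∫ x, f x ∂μ := by
    intro f
    have := L2.inner_indicatorConstLp_one (𝕜 := ℝ) MeasurableSet.univ (measure_ne_top μ _) f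
    rw [this]; simp
  have hmem : ∀ w : EuclideanSpace ℝ (Fin d) → ℝ, Measurable w → (∀ x, |w x| ≤ M) →
      (∀ᵐ x ∂P, ENNReal.ofReal (∑ i, w (x i)) ≤ coulomb x) →
      ∃ f ∈ A, ∫ x, f x ∂μ = ∫ x, w x ∂μ := by
    intro w hw hwM hwf
    have hL : MemLp w 2 μ := MemLp.of_bound hw.aestronglyMeasurable M (ae_of_all _ hwM)
    refine ⟨hL.toLp w, ⟨?_, ?_⟩, integral_congr_ae hL.coeFn_toLp⟩
    · filter_upwards [hL.coeFn_toLp] with x hx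
      rw [hx]; exact hwM x
    · filter_upwards [ae_pi_of_ae (N := N) μ hL.coeFn_toLp, hwf] with x hx h2
      simp only [hx]; exact h2
  have hAbd : ∀ f ∈ A, ∫ x, f x ∂μ ≤ M := by
    intro f hf
    have h1 : Integrable f μ := (Lp.memLp f).integrable (by norm_num)
    calc _ ≤ ∫ x, M ∂μ := integral_mono_ae h1 (integrable_const _) (by
            filter_upwards [hf.1] with x hx using (le_abs_self _).trans hx)
      _ = M := by simp
  obtain ⟨R, hAn⟩ : ∃ R, ∀ f ∈ A, ‖f‖ ≤ R :=
    ⟨_, fun f hf => Lp.norm_le_of_ae_bound (f := f) hM hf.1⟩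
  let V : Set ℝ := (fun f : Lp ℝ 2 μ => ∫ x, f x ∂μ) '' A
  have hVb : BddAbove V := ⟨M, by rintro _ ⟨f, hf, rfl⟩; exact hAbd f hf⟩
  have hVne : V.Nonempty := by
    obtain ⟨f, hf, -⟩ := hmem (fun _ => 0) measurable_const (by simpa using hM) (by simp)
    exact ⟨_, f, hf, rfl⟩
  let C : ℕ → Set (Lp ℝ 2 μ) := fun n => A ∩ {f | sSup V - 1 / ((n : ℝ) + 1) ≤ inner ℝ one f}
  obtain ⟨f, hf⟩ : (⋂ n, C n).Nonempty := by
    refine hilbert_nested C ?_ ?_ ?_ ?_ R ?_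
    · intro n m hnm f hf
      have h1 := Nat.one_div_le_one_div (α := ℝ) hnm
      have h2 : sSup V - 1 / ((m : ℝ) + 1) ≤ inner ℝ one f := hf.2
      have h3 : sSup V - 1 / ((n : ℝ) + 1) ≤ inner ℝ one f := by linarith
      exact ⟨hf.1, h3⟩
    · intro n
      have : sSup V - 1 / ((n : ℝ) + 1) < sSup V := by
        have : 0 < 1 / ((n : ℝ) + 1) := by positivity
        linarith
      obtain ⟨_, ⟨f, hf, rfl⟩, h⟩ := exists_lt_of_lt_csSup hVne this
      refine ⟨f, hf, ?_⟩
      simp only [Set.mem_ofPred_eq, hIntg]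
      exact h.le
    · intro n
      exact hAcl.inter (isClosed_le continuous_const (by fun_prop))
    · intro n
      refine hAcv.inter ?_
      intro f hf g hg a b ha hb hab
      simp only [Set.mem_ofPred_eq] at *
      rw [inner_add_right, inner_smul_right, inner_smul_right]
      calc sSup V - 1 / ((n : ℝ) + 1) = a * (sSup V - 1 / ((n : ℝ) + 1)) +
            b * (sSup V - 1 / ((n : ℝ) + 1)) := by rw [← add_mul, hab, one_mul]
        _ ≤ _ := by gcongr
    · intro f hf
      exact hAn f hf.1
  have hf' : ∀ n, f ∈ C n := fun n => Set.mem_iInter.1 hf n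
  have hfA : f ∈ A := (hf' 0).1
  have hfmax : sSup V ≤ ∫ x, f x ∂μ := by
    rw [← hIntg]
    have h1 : Tendsto (fun n : ℕ => sSup V - 1 / ((n : ℝ) + 1)) atTop (𝓝 (sSup V - 0)) :=
      tendsto_const_nhds.sub tendsto_one_div_add_atTop_nhds_zero_nat
    rw [sub_zero] at h1
    exact le_of_tendsto h1 (Eventually.of_forall fun n => (hf' n).2)
  have hfm : Measurable f := (Lp.stronglyMeasurable f).measurable
  let u : EuclideanSpace ℝ (Fin d) → ℝ := fun x => max (-M) (min M (f x))
  have hueq : ∀ᵐ x ∂μ, u x = f x := by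
    filter_upwards [hfA.1] with x hx
    have := abs_le.1 hx
    simp [u, this.1, this.2]
  refine ⟨u, by fun_prop, fun x => ?_, ?_, ?_⟩
  · rw [abs_le]
    exact ⟨le_max_left _ _, max_le (by linarith) (min_le_left _ _)⟩
  · filter_upwards [ae_pi_of_ae (N := N) μ hueq, hfA.2] with x h1 h2
    simp only [h1]; exact h2
  · intro w hw hwM hwf
    obtain ⟨g, hg, hgw⟩ := hmem w hw hwM hwf
    rw [← hgw, integral_congr_ae hueq]
    exact (le_csSup hVb ⟨g, hg, rfl⟩).trans hfmax

/-- Dual admissibility hypothesis: `D` bounds all symmetric dual values. -/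
def DualBound {d : ℕ} (N : ℕ) (μ : Measure (EuclideanSpace ℝ (Fin d))) (D : ℝ) : Prop :=
  ∀ u : EuclideanSpace ℝ (Fin d) → ℝ, Measurable u → (∃ B, ∀ x, |u x| ≤ B) →
    (∀ x : Fin N → EuclideanSpace ℝ (Fin d), ENNReal.ofReal (∑ i, u (x i)) ≤ coulomb x) →
    (N : ℝ) * ∫ x, u x ∂μ ≤ D

theorem integrable_of_bdd {d : ℕ} (μ : Measure (EuclideanSpace ℝ (Fin d)))
    [IsProbabilityMeasure μ] {u : EuclideanSpace ℝ (Fin d) → ℝ} (hu : Measurable u) {B : ℝ}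
    (hB : ∀ x, |u x| ≤ B) : Integrable u μ :=
  Integrable.of_bound hu.aestronglyMeasurable B (ae_of_all _ hB)

theorem DualBound.tuple {d N : ℕ} (hN : N ≠ 0) {μ : Measure (EuclideanSpace ℝ (Fin d))}
    [IsProbabilityMeasure μ] {D : ℝ} (hD : DualBound N μ D)
    (u : Fin N → EuclideanSpace ℝ (Fin d) → ℝ) (hu : ∀ i, Measurable (u i)) (B : ℝ)
    (hB : ∀ i x, |u i x| ≤ B)
    (hf : ∀ x, coulomb x ≠ ∞ → ∑ i, u i (x i) ≤ (coulomb x).toReal) :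
    ∑ i, ∫ x, u i x ∂μ ≤ D := by
  have : NeZero N := ⟨hN⟩
  have hNpos : (0 : ℝ) < N := by exact_mod_cast Nat.pos_of_ne_zero hN
  have hsum : ∀ x, |∑ k, u k x| ≤ N * B := by
    intro x
    calc _ ≤ ∑ k, |u k x| := Finset.abs_sum_le_sum_abs _ _
      _ ≤ ∑ k : Fin N, B := Finset.sum_le_sum fun k _ => hB k x
      _ = _ := by simp
  have h := hD (fun x => (N : ℝ)⁻¹ * ∑ k, u k x) (by fun_prop)
    ⟨(N : ℝ)⁻¹ * (N * B), fun x => by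
      rw [abs_mul, abs_of_pos (inv_pos.2 hNpos)]
      gcongr
      exact hsum x⟩ (by
      intro x
      rw [ofReal_le_iff]
      intro hc
      rw [← Finset.mul_sum]
      have e1 : ∑ i, ∑ k, u k (x i) = ∑ s : Fin N, ∑ k, u k (x (k + s)) := by
        rw [Finset.sum_comm]
        conv_rhs => rw [Finset.sum_comm]
        refine Finset.sum_congr rfl fun k _ => ?_
        exact (Equiv.sum_comp (Equiv.addLeft k) (fun i => u k (x i))).symm
      have e2 : ∀ s : Fin N, ∑ k, u k (x (k + s)) ≤ (coulomb x).toReal := by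
        intro s
        have hp := coulomb_perm x (Equiv.addRight s)
        have := hf (fun k => x (Equiv.addRight s k)) (by rw [hp]; exact hc)
        rw [hp] at this
        exact this
      rw [e1]
      calc _ ≤ (N : ℝ)⁻¹ * ∑ s : Fin N, (coulomb x).toReal := by
            gcongr with s
            exact e2 s
        _ = _ := by simp [hN])
  have hi : ∫ x, (N : ℝ)⁻¹ * ∑ k, u k x ∂μ = (N : ℝ)⁻¹ * ∑ k, ∫ x, u k x ∂μ := by
    rw [integral_const_mul, integral_finsetSum _ fun k _ => integrable_of_bdd μ (hu k) (hB k)]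
  rw [hi, mul_inv_cancel_left₀ hNpos.ne'] at h
  exact h

/-- `a` is the value of a dual majorant of `f`. -/
def Dom {d N : ℕ} (μ : Measure (EuclideanSpace ℝ (Fin d))) (D : ℝ)
    (f : (Fin N → EuclideanSpace ℝ (Fin d)) → ℝ) (a : ℝ) : Prop :=
  ∃ (u : Fin N → EuclideanSpace ℝ (Fin d) → ℝ) (t : ℝ), 0 ≤ t ∧ (∀ i, Measurable (u i)) ∧
    (∃ B, ∀ i x, |u i x| ≤ B) ∧
    (∀ x, coulomb x ≠ ∞ → f x ≤ ∑ i, u i (x i) + t * (coulomb x).toReal) ∧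
    ∑ i, ∫ x, u i x ∂μ + t * D ≤ a

theorem Dom.add {d N : ℕ} {μ : Measure (EuclideanSpace ℝ (Fin d))} [IsProbabilityMeasure μ] {D : ℝ}
    {f g : (Fin N → EuclideanSpace ℝ (Fin d)) → ℝ} {a b : ℝ} (hf : Dom μ D f a)
    (hg : Dom μ D g b) : Dom μ D (fun x => f x + g x) (a + b) := by
  obtain ⟨u, t, ht, hu, ⟨B, hB⟩, h1, h2⟩ := hf
  obtain ⟨u', t', ht', hu', ⟨B', hB'⟩, h1', h2'⟩ := hg
  refine ⟨fun i x => u i x + u' i x, t + t', by positivity, fun i => (hu i).add (hu' i),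
    ⟨B + B', fun i x => (abs_add_le _ _).trans (add_le_add (hB i x) (hB' i x))⟩, ?_, ?_⟩
  · intro x hx
    rw [Finset.sum_add_distrib]
    linarith [h1 x hx, h1' x hx]
  · have : ∀ i, ∫ x, u i x + u' i x ∂μ = ∫ x, u i x ∂μ + ∫ x, u' i x ∂μ := fun i =>
      integral_add (integrable_of_bdd μ (hu i) (hB i)) (integrable_of_bdd μ (hu' i) (hB' i))
    simp only [this]
    rw [Finset.sum_add_distrib]
    linarith

theorem Dom.smul {d N : ℕ} {μ : Measure (EuclideanSpace ℝ (Fin d))} {D : ℝ}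
    {f : (Fin N → EuclideanSpace ℝ (Fin d)) → ℝ} {a : ℝ} (hf : Dom μ D f a) {c : ℝ} (hc : 0 < c) :
    Dom μ D (fun x => c * f x) (c * a) := by
  obtain ⟨u, t, ht, hu, ⟨B, hB⟩, h1, h2⟩ := hf
  refine ⟨fun i x => c * u i x, c * t, by positivity, fun i => (hu i).const_mul c,
    ⟨c * B, fun i x => ?_⟩, ?_, ?_⟩
  · rw [abs_mul, abs_of_pos hc]
    gcongr
    exact hB i x
  · intro x hx
    rw [← Finset.mul_sum, mul_assoc, ← mul_add]
    exact mul_le_mul_of_nonneg_left (h1 x hx) hc.le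
  · simp only [integral_const_mul]
    rw [← Finset.mul_sum, mul_assoc, ← mul_add]
    gcongr

theorem Dom.lower {d N : ℕ} (hN : N ≠ 0) {μ : Measure (EuclideanSpace ℝ (Fin d))}
    [IsProbabilityMeasure μ] {D : ℝ} (hD : DualBound N μ D)
    {f : (Fin N → EuclideanSpace ℝ (Fin d)) → ℝ} {a : ℝ} (hf : Dom μ D f a) {K : ℝ}
    (hK : ∀ x, -K ≤ f x) : -K ≤ a := by
  obtain ⟨u, t, ht, hu, ⟨B, hB⟩, h1, h2⟩ := hf
  have hNpos : (0 : ℝ) < N := by exact_mod_cast Nat.pos_of_ne_zero hN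
  have key : ∀ s, t < s → -∑ i, ∫ x, u i x ∂μ - K ≤ s * D := by
    intro s hs
    have hs0 : 0 < s := ht.trans_lt hs
    have h := hD.tuple hN (fun i x => s⁻¹ * (-u i x - (N : ℝ)⁻¹ * K))
      (fun i => ((hu i).neg.sub_const _).const_mul _) (s⁻¹ * (B + |(N : ℝ)⁻¹ * K|))
      (fun i x => by
        rw [abs_mul, abs_of_pos (inv_pos.2 hs0)]
        gcongr
        refine (abs_sub _ _).trans ?_
        rw [abs_neg]
        gcongr
        exact hB i x)
      (fun x hx => by
        rw [← Finset.mul_sum, Finset.sum_sub_distrib, Finset.sum_neg_distrib]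
        simp only [Finset.sum_const, Finset.card_univ, Fintype.card_fin, nsmul_eq_mul]
        rw [mul_inv_cancel_left₀ hNpos.ne', inv_mul_le_iff₀ hs0]
        have h3 := h1 x hx
        have h4 : t * (coulomb x).toReal ≤ s * (coulomb x).toReal :=
          mul_le_mul_of_nonneg_right hs.le ENNReal.toReal_nonneg
        linarith [hK x])
    have hi : ∀ i, ∫ x, s⁻¹ * (-u i x - (N : ℝ)⁻¹ * K) ∂μ =
        s⁻¹ * (-∫ x, u i x ∂μ - (N : ℝ)⁻¹ * K) := by
      intro i
      rw [integral_const_mul, integral_sub (f := fun x => -u i x) (integrable_of_bdd μ (hu i) (hB i)).neg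
        (integrable_const _), integral_neg]
      simp
    simp only [hi] at h
    rw [← Finset.mul_sum, Finset.sum_sub_distrib, Finset.sum_neg_distrib] at h
    simp only [Finset.sum_const, Finset.card_univ, Fintype.card_fin, nsmul_eq_mul] at h
    rwa [mul_inv_cancel_left₀ hNpos.ne', inv_mul_le_iff₀ hs0] at h
  have hlim : -∑ i, ∫ x, u i x ∂μ - K ≤ t * D := by
    have h5 : Tendsto (fun s : ℝ => s * D) (𝓝[>] t) (𝓝 (t * D)) :=
      ((continuous_id.mul continuous_const).tendsto t).mono_left nhdsWithin_le_nhds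
    refine ge_of_tendsto h5 ?_
    filter_upwards [self_mem_nhdsWithin] with s hs using key s hs
  linarith

theorem Dom.const {d N : ℕ} (hN : N ≠ 0) {μ : Measure (EuclideanSpace ℝ (Fin d))}
    [IsProbabilityMeasure μ] {D : ℝ}
    {f : (Fin N → EuclideanSpace ℝ (Fin d)) → ℝ} {K : ℝ} (hK : ∀ x, f x ≤ K) : Dom μ D f K := by
  have hNpos : (0 : ℝ) < N := by exact_mod_cast Nat.pos_of_ne_zero hN
  refine ⟨fun _ _ => (N : ℝ)⁻¹ * K, 0, le_rfl, fun _ => measurable_const, ⟨_, fun _ _ => le_rfl⟩,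
    ?_, ?_⟩
  · intro x _
    simp only [Finset.sum_const, Finset.card_univ, Fintype.card_fin, nsmul_eq_mul]
    rw [mul_inv_cancel_left₀ hNpos.ne']
    simpa using hK x
  · simp [hN]

open CompactlySupported in
/-- The Hahn-Banach step: a linear functional below the dual sublinear functional. -/
theorem exists_functional {d N : ℕ} (hN : N ≠ 0) (μ : Measure (EuclideanSpace ℝ (Fin d)))
    [IsProbabilityMeasure μ] {D : ℝ} (hD : DualBound N μ D) :
    ∃ L : C_c((Fin N → EuclideanSpace ℝ (Fin d)), ℝ) →ₗ[ℝ] ℝ, ∀ (f : C_c((Fin N → EuclideanSpace ℝ (Fin d)), ℝ)) (a : ℝ),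
      Dom μ D f a → L f ≤ a := by
  let S : C_c((Fin N → EuclideanSpace ℝ (Fin d)), ℝ) → Set ℝ := fun f => {a | Dom μ D f a}
  have hbd : ∀ f : C_c((Fin N → EuclideanSpace ℝ (Fin d)), ℝ), ∃ K, ∀ x, |f x| ≤ K := by
    intro f
    obtain ⟨K, hK⟩ := f.hasCompactSupport.exists_bound_of_continuous f.continuous
    exact ⟨K, hK⟩
  have hSb : ∀ f, BddBelow (S f) := by
    intro f
    obtain ⟨K, hK⟩ := hbd f
    exact ⟨-K, fun a ha => Dom.lower hN hD ha fun x => (abs_le.1 (hK x)).1⟩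
  have hSn : ∀ f, (S f).Nonempty := by
    intro f
    obtain ⟨K, hK⟩ := hbd f
    exact ⟨K, Dom.const hN fun x => (abs_le.1 (hK x)).2⟩
  have hle : ∀ (c : ℝ), 0 < c → ∀ f, sInf (S (c • f)) ≤ c * sInf (S f) := by
    intro c hc f
    rw [← div_le_iff₀' hc]
    refine le_csInf (hSn f) fun a ha => ?_
    rw [div_le_iff₀' hc]
    exact csInf_le (hSb _) (Dom.smul ha hc)
  obtain ⟨L, -, hL⟩ := exists_extension_of_le_sublinear
    (⟨⊥, 0⟩ : C_c((Fin N → EuclideanSpace ℝ (Fin d)), ℝ) →ₗ.[ℝ] ℝ) (fun f => sInf (S f))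
    (by
      intro c hc f
      refine le_antisymm (hle c hc f) ?_
      have := hle c⁻¹ (inv_pos.2 hc) (c • f)
      rw [smul_smul, inv_mul_cancel₀ hc.ne', one_smul] at this
      rwa [← le_inv_mul_iff₀ hc])
    (by
      intro f g
      have h1 : ∀ a ∈ S f, sInf (S (f + g)) - a ≤ sInf (S g) := by
        intro a ha
        refine le_csInf (hSn g) fun b hb => ?_
        rw [sub_le_iff_le_add']
        exact csInf_le (hSb _) (Dom.add ha hb)
      have h2 : sInf (S (f + g)) - sInf (S g) ≤ sInf (S f) :=
        le_csInf (hSn f) fun a ha => by linarith [h1 a ha]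
      linarith)
    (by
      rintro ⟨f, hf⟩
      have hf0 : f = 0 := by simpa using hf
      subst hf0
      change (0 : ℝ) ≤ sInf (S 0)
      refine le_csInf (hSn 0) fun a ha => ?_
      have := Dom.lower hN hD (K := 0) ha (by simp)
      linarith)
  exact ⟨L, fun f a ha => (hL f).trans (csInf_le (hSb f) ha)⟩

open CompactlySupported in
/-- A cutoff function. -/
theorem exists_cutoff {d N : ℕ} (g : (Fin N → EuclideanSpace ℝ (Fin d)) → ℝ) (hg : Continuous g)
    (m : ℕ) : ∃ f : C_c((Fin N → EuclideanSpace ℝ (Fin d)), ℝ), ∃ χ : _ → ℝ,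
      (∀ x, f x = g x * χ x) ∧ (∀ x, 0 ≤ χ x ∧ χ x ≤ 1) ∧ ∀ x, ‖x‖ ≤ m → χ x = 1 := by
  let χ : (Fin N → EuclideanSpace ℝ (Fin d)) → ℝ := fun x => max 0 (min 1 (m + 1 - ‖x‖))
  have hχ : Continuous χ := by fun_prop
  have hsupp : HasCompactSupport (fun x => g x * χ x) := by
    refine HasCompactSupport.intro (isCompact_closedBall 0 ((m : ℝ) + 1)) fun x hx => ?_
    have : (m : ℝ) + 1 < ‖x‖ := by simpa using hx
    have h0 : χ x = 0 := max_eq_left ((min_le_right _ _).trans (by linarith))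
    rw [h0, mul_zero]
  refine ⟨⟨⟨fun x => g x * χ x, hg.mul hχ⟩, hsupp⟩, χ, fun x => rfl, fun x => ⟨le_max_left _ _,
    max_le zero_le_one (min_le_left _ _)⟩, fun x hx => ?_⟩
  have h1 : min 1 ((m : ℝ) + 1 - ‖x‖) = 1 := min_eq_left (by linarith)
  simp [χ, h1]

open CompactlySupported in
theorem exists_plan {d N : ℕ} (hN : N ≠ 0) (μ : Measure (EuclideanSpace ℝ (Fin d)))
    [IsProbabilityMeasure μ] {D : ℝ} (hD : DualBound N μ D) :
    ∃ γ : Measure (Fin N → EuclideanSpace ℝ (Fin d)), IsProbabilityMeasure γ ∧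
      (∀ i, γ.map (fun x => x i) = μ) ∧ ∫⁻ x, coulomb x ∂γ ≤ ENNReal.ofReal D := by
  obtain ⟨L, hL⟩ := exists_functional hN μ hD
  have hpos : ∀ f : C_c((Fin N → EuclideanSpace ℝ (Fin d)), ℝ), 0 ≤ f → 0 ≤ L f := by
    intro f hf
    have h1 : L (-f) ≤ 0 := hL (-f) 0 (Dom.const hN fun x => by
      have : 0 ≤ f x := hf x
      simpa using this)
    rw [map_neg] at h1
    linarith
  let Λ : C_c((Fin N → EuclideanSpace ℝ (Fin d)), ℝ) →ₚ[ℝ] ℝ := PositiveLinearMap.mk₀ L hpos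
  let γ := RealRMK.rieszMeasure Λ
  have hΛ : ∀ f, ∫ x, f x ∂γ = L f := fun f => RealRMK.integral_rieszMeasure Λ f
  have hcont : ∀ i : Fin N, Continuous fun x : Fin N → EuclideanSpace ℝ (Fin d) => x i :=
    fun i => continuous_apply i
  have hreg : γ.Regular := by infer_instance
  -- marginals are below `μ` on open sets
  have hopen : ∀ (i : Fin N) (U : Set (EuclideanSpace ℝ (Fin d))), IsOpen U →
      γ ((fun x => x i) ⁻¹' U) ≤ μ U := by
    intro i U hU
    have hV : IsOpen ((fun x : Fin N → EuclideanSpace ℝ (Fin d) => x i) ⁻¹' U) :=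
      hU.preimage (hcont i)
    rw [hV.measure_eq_iSup_isCompact]
    refine iSup₂_le fun K hKV => iSup_le fun hK => ?_
    obtain ⟨f, hf1, hf2, hf3, hf4⟩ := exists_continuousMap_one_of_isCompact_subset_isOpen hK hV hKV
    let F : C_c((Fin N → EuclideanSpace ℝ (Fin d)), ℝ) := ⟨f, hf2⟩
    have h1 : γ K ≤ ENNReal.ofReal (L F) :=
      RealRMK.rieszMeasure_le_of_eq_one Λ (f := F) (fun x => (hf4 x).1) hK (fun x hx => hf1 hx)
    have h2 : L F ≤ μ.real U := by
      refine hL F _ ⟨fun j => if j = i then U.indicator (fun _ => 1) else fun _ => 0, 0, le_rfl,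
        ?_, ⟨1, ?_⟩, ?_, ?_⟩
      · intro j
        dsimp only
        split_ifs
        · exact measurable_const.indicator hU.measurableSet
        · exact measurable_const
      · intro j x
        dsimp only
        split_ifs
        · by_cases hx : x ∈ U <;> simp [hx]
        · simp
      · intro x _
        rw [Finset.sum_eq_single i (by intro j _ hj; simp [hj]) (by simp)]
        simp only [if_true, zero_mul, add_zero]
        by_cases hx : x i ∈ U
        · rw [Set.indicator_of_mem hx]; exact (hf4 x).2
        · rw [Set.indicator_of_notMem hx]
          have : f x = 0 := by
            by_contra hne
            exact hx (hf3 (subset_tsupport _ hne))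
          exact this.le
      · rw [Finset.sum_eq_single i (by intro j _ hj; simp [hj]) (by simp)]
        simp [integral_indicator hU.measurableSet]
    calc γ K ≤ ENNReal.ofReal (L F) := h1
      _ ≤ ENNReal.ofReal (μ.real U) := ENNReal.ofReal_le_ofReal h2
      _ = μ U := ofReal_measureReal
  let i0 : Fin N := ⟨0, Nat.pos_of_ne_zero hN⟩
  have hle1 : γ Set.univ ≤ 1 := by
    have := hopen i0 Set.univ isOpen_univ
    simpa using this
  have hfin : IsFiniteMeasure γ := ⟨hle1.trans_lt ENNReal.one_lt_top⟩
  have hge : ∀ m : ℕ, ENNReal.ofReal (1 - N * μ.real (Metric.closedBall 0 m)ᶜ) ≤ γ Set.univ := by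
    intro m
    obtain ⟨f, χ, h1, h2, h3⟩ := exists_cutoff (d := d) (N := N) (fun _ => 1) continuous_const m
    simp only [one_mul] at h1
    have hKm : MeasurableSet (Metric.closedBall (0 : EuclideanSpace ℝ (Fin d)) m)ᶜ :=
      Metric.isClosed_closedBall.measurableSet.compl
    have h4 : L (-f) ≤ -1 + N * μ.real (Metric.closedBall 0 m)ᶜ := by
      have hd1 : Dom (N := N) μ D (fun _ => (-1 : ℝ)) (-1) := Dom.const hN fun x => le_rfl
      have hd2 : Dom (N := N) μ D (fun x => 1 + (-f) x) (N * μ.real (Metric.closedBall 0 m)ᶜ) := by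
        refine ⟨fun j => (Metric.closedBall 0 (m : ℝ))ᶜ.indicator (fun _ => 1), 0, le_rfl,
          fun j => measurable_const.indicator hKm, ⟨1, ?_⟩, ?_, ?_⟩
        · intro j x
          dsimp only
          by_cases hx : x ∈ (Metric.closedBall (0 : EuclideanSpace ℝ (Fin d)) (m : ℝ))ᶜ
          · rw [Set.indicator_of_mem hx]; simp
          · rw [Set.indicator_of_notMem hx]; simp
        · intro x _
          simp only [CompactlySupportedContinuousMap.coe_neg, Pi.neg_apply, h1, zero_mul, add_zero]
          have hnn : ∀ j : Fin N, 0 ≤ (Metric.closedBall (0 : EuclideanSpace ℝ (Fin d)) (m : ℝ))ᶜ.indicator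
              (fun _ => (1 : ℝ)) (x j) := fun j => Set.indicator_nonneg (fun _ _ => zero_le_one) _
          by_cases hx : ‖x‖ ≤ m
          · rw [h3 x hx]
            simpa using Finset.sum_nonneg fun j _ => hnn j
          · obtain ⟨j, hj⟩ : ∃ j, (m : ℝ) < ‖x j‖ := by
              by_contra hcon
              push Not at hcon
              exact hx ((pi_norm_le_iff_of_nonneg (by positivity)).2 hcon)
            have h5 := Finset.single_le_sum (fun j _ => hnn j) (Finset.mem_univ j)
            rw [Set.indicator_of_mem (by simpa using hj)] at h5
            linarith [(h2 x).1]
        · simp [integral_indicator hKm]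
      refine hL (-f) _ ?_
      have := hd1.add hd2
      have e : (⇑(-f) : (Fin N → EuclideanSpace ℝ (Fin d)) → ℝ) = fun x => -1 + (1 + (-f) x) := by
        funext x
        ring
      rw [e]
      exact this
    rw [map_neg] at h4
    have h5 : L f ≤ γ.real Set.univ := by
      rw [← hΛ f]
      have : ∫ x, f x ∂γ ≤ ∫ x, (1 : ℝ) ∂γ :=
        integral_mono (f.continuous.integrable_of_hasCompactSupport f.hasCompactSupport)
          (integrable_const _) fun x => by
            rw [h1]; exact (h2 x).2
      simpa using this
    rw [← ofReal_measureReal (μ := γ)]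
    exact ENNReal.ofReal_le_ofReal (by linarith)
  have hlim0 : Tendsto (fun m : ℕ => μ (Metric.closedBall 0 (m : ℝ))ᶜ) atTop (𝓝 0) := by
    have h := tendsto_measure_iInter_atTop (μ := μ)
      (s := fun m : ℕ => (Metric.closedBall (0 : EuclideanSpace ℝ (Fin d)) (m : ℝ))ᶜ)
      (fun m => Metric.isClosed_closedBall.measurableSet.compl.nullMeasurableSet)
      (fun a b hab => Set.compl_subset_compl.2 (Metric.closedBall_subset_closedBall
        (by exact_mod_cast hab))) ⟨0, measure_ne_top _ _⟩
    rw [← Set.compl_iUnion, Metric.iUnion_closedBall_nat] at h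
    simpa [Function.comp_def] using h
  have hge1 : 1 ≤ γ Set.univ := by
    have h1 : Tendsto (fun m : ℕ => μ.real (Metric.closedBall 0 (m : ℝ))ᶜ) atTop (𝓝 0) := by
      have := (ENNReal.tendsto_toReal (a := 0) (by simp)).comp hlim0
      rw [ENNReal.toReal_zero] at this
      exact this
    have h2 : Tendsto (fun m : ℕ => ENNReal.ofReal (1 - N * μ.real (Metric.closedBall 0 (m : ℝ))ᶜ))
        atTop (𝓝 (ENNReal.ofReal (1 - N * 0))) :=
      ENNReal.tendsto_ofReal (tendsto_const_nhds.sub (h1.const_mul _))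
    have h3 := le_of_tendsto h2 (Eventually.of_forall hge)
    simpa using h3
  have hprob : IsProbabilityMeasure γ := ⟨le_antisymm hle1 hge1⟩
  refine ⟨γ, hprob, fun i => ?_, ?_⟩
  · have hmi : Measurable fun x : Fin N → EuclideanSpace ℝ (Fin d) => x i := measurable_pi_apply i
    have hle : γ.map (fun x => x i) ≤ μ := by
      refine Measure.le_iff.2 fun s hs => ?_
      refine le_of_forall_gt fun c hc => ?_
      obtain ⟨U, hsU, hU, hUc⟩ := s.exists_isOpen_lt_of_lt c hc
      refine lt_of_le_of_lt (measure_mono hsU) (lt_of_le_of_lt ?_ hUc)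
      rw [Measure.map_apply hmi hU.measurableSet]
      exact hopen i U hU
    have hp : IsProbabilityMeasure (γ.map (fun x => x i)) :=
      Measure.isProbabilityMeasure_map hmi.aemeasurable
    exact Measure.eq_of_le_of_measure_univ_eq hle (by simp)
  · have hgc : ∀ m : ℕ, Continuous fun x : Fin N → EuclideanSpace ℝ (Fin d) =>
        (min (coulomb x) m).toReal := by
      intro m
      refine ENNReal.continuousOn_toReal.comp_continuous
        (continuous_coulomb.min continuous_const) fun x => ?_
      exact (lt_of_le_of_lt (min_le_right _ _) (ENNReal.natCast_lt_top m)).ne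
    choose f χ h1 h2 h3 using fun m : ℕ => exists_cutoff _ (hgc m) m
    have hlim : ∀ x, Tendsto (fun m => ENNReal.ofReal (f m x)) atTop (𝓝 (coulomb x)) := by
      intro x
      have ht : Tendsto (fun m : ℕ => min (coulomb x) (m : ℝ≥0∞)) atTop (𝓝 (min (coulomb x) ⊤)) :=
        tendsto_const_nhds.min ENNReal.tendsto_nat_nhds_top
      rw [min_top_right] at ht
      refine ht.congr' ?_
      obtain ⟨n, hn⟩ := exists_nat_ge ‖x‖
      filter_upwards [eventually_ge_atTop n] with m hm
      rw [h1, h3 m x (hn.trans (by exact_mod_cast hm)), mul_one, ENNReal.ofReal_toReal]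
      exact (lt_of_le_of_lt (min_le_right _ _) (ENNReal.natCast_lt_top m)).ne
    have hbound : ∀ m, ∫⁻ x, ENNReal.ofReal (f m x) ∂γ ≤ ENNReal.ofReal D := by
      intro m
      have hnn : ∀ x, 0 ≤ f m x := fun x => by
        rw [h1]; exact mul_nonneg ENNReal.toReal_nonneg (h2 m x).1
      have hIntg : Integrable (fun x => f m x) γ :=
        (f m).continuous.integrable_of_hasCompactSupport (f m).hasCompactSupport
      rw [← ofReal_integral_eq_lintegral_ofReal hIntg
        (ae_of_all _ hnn), hΛ]
      refine ENNReal.ofReal_le_ofReal (hL _ _ ?_)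
      refine ⟨fun _ _ => 0, 1, zero_le_one, fun _ => measurable_const, ⟨0, by simp⟩, ?_, by simp⟩
      intro x hx
      rw [h1]
      have h4 : (min (coulomb x) m).toReal ≤ (coulomb x).toReal :=
        ENNReal.toReal_mono hx (min_le_left _ _)
      have h5 := mul_le_of_le_one_right (ENNReal.toReal_nonneg (a := min (coulomb x) m)) (h2 m x).2
      simp only [Finset.sum_const_zero, zero_add, one_mul]
      exact h5.trans h4
    calc ∫⁻ x, coulomb x ∂γ = ∫⁻ x, liminf (fun m => ENNReal.ofReal (f m x)) atTop ∂γ :=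
          lintegral_congr fun x => (hlim x).liminf_eq.symm
      _ ≤ liminf (fun m => ∫⁻ x, ENNReal.ofReal (f m x) ∂γ) atTop :=
          lintegral_liminf_le fun m => (f m).continuous.measurable.ennreal_ofReal
      _ ≤ ENNReal.ofReal D := by
          refine (liminf_le_liminf (Eventually.of_forall hbound)).trans ?_
          simp

end DePascale

/-- **De Pascale's duality theorem** for the multi-marginal problem with Coulomb cost: if `μ` is
an absolutely continuous Borel probability measure on `ℝ^d` not concentrated on any set of at
most `N − 1` points, then the Kantorovich minimum over plans in `Π_N(μ)` equals the dual maximum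
`N ∫ u dμ`, and the dual maximum is attained by a bounded potential `u ∈ L¹(μ)`. -/
theorem depascale_coulomb_duality {d N : ℕ}
    (μ : Measure (EuclideanSpace ℝ (Fin d))) [IsProbabilityMeasure μ]
    (hac : μ ≪ volume)
    (hcard : ∀ s : Set (EuclideanSpace ℝ (Fin d)), s.Finite → s.ncard ≤ N - 1 → μ sᶜ ≠ 0) :
    ∃ u : EuclideanSpace ℝ (Fin d) → ℝ, Measurable u ∧ Integrable u μ ∧
      (∃ M : ℝ, ∀ x, |u x| ≤ M) ∧
      (∀ᵐ x ∂(Measure.pi fun _ : Fin N => μ), ENNReal.ofReal (∑ i, u (x i)) ≤ coulomb x) ∧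
      (∀ v : EuclideanSpace ℝ (Fin d) → ℝ, Integrable v μ →
        (∀ᵐ x ∂(Measure.pi fun _ : Fin N => μ), ENNReal.ofReal (∑ i, v (x i)) ≤ coulomb x) →
        (N : ℝ) * ∫ x, v x ∂μ ≤ (N : ℝ) * ∫ x, u x ∂μ) ∧
      IsLeast {r : ℝ≥0∞ | ∃ γ : Measure (Fin N → EuclideanSpace ℝ (Fin d)),
          IsProbabilityMeasure γ ∧ (∀ i, γ.map (fun x => x i) = μ) ∧ r = ∫⁻ x, coulomb x ∂γ}
        (ENNReal.ofReal ((N : ℝ) * ∫ x, u x ∂μ)) := by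
  by_cases hN : N ≤ 1
  · -- trivial case
    have hc : ∀ x : Fin N → EuclideanSpace ℝ (Fin d), coulomb x = 0 := by
      intro x
      have : Subsingleton (Fin N) := Fin.subsingleton_iff_le_one.2 hN
      unfold coulomb
      refine Finset.sum_eq_zero fun i _ => Finset.sum_eq_zero fun j hj => ?_
      exact absurd (Subsingleton.elim i j) (Finset.mem_Ioi.1 hj).ne
    have hm : Measurable fun (x : EuclideanSpace ℝ (Fin d)) (_ : Fin N) => x :=
      measurable_pi_lambda _ fun _ => measurable_id
    have hmarg : ∀ i : Fin N,
        (μ.map fun (x : EuclideanSpace ℝ (Fin d)) (_ : Fin N) => x).map (fun x => x i) = μ := by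
      intro i
      rw [Measure.map_map (measurable_pi_apply i) hm]
      exact Measure.map_id
    refine ⟨fun _ => 0, measurable_const, integrable_const _, ⟨0, by simp⟩, by simp, ?_, ?_, ?_⟩
    · intro v hv hvf
      have := DePascale.weak_duality μ v hv hvf _ hmarg
      simp only [hc, lintegral_zero, nonpos_iff_eq_zero, ENNReal.ofReal_eq_zero] at this
      simpa using this
    · exact ⟨_, Measure.isProbabilityMeasure_map hm.aemeasurable, hmarg, by simp [hc]⟩
    · intro r _
      simp
  push Not at hN
  have hd : d ≠ 0 := by
    rintro rfl
    refine hcard {0} (Set.finite_singleton _) (by rw [Set.ncard_singleton]; omega) ?_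
    have : ({0} : Set (EuclideanSpace ℝ (Fin 0)))ᶜ = ∅ := by
      ext x
      simp [Subsingleton.elim x 0]
    rw [this, measure_empty]
  have hNpos : (0 : ℝ) < N := by exact_mod_cast (by omega : 0 < N)
  obtain ⟨r, hr, hb⟩ := DePascale.small_balls hd μ hac (ENNReal.ofReal (1 / (2 * N ^ 3)))
    (by simp only [ne_eq, ENNReal.ofReal_eq_zero, not_le]; positivity)
  set A : ℝ := 2 * (N * (N * r⁻¹)) with hA
  have hA0 : 0 ≤ A := by positivity
  obtain ⟨u, hum, huM, huf, humax⟩ :=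
    DePascale.exists_maximizer (N := N) μ (N * A) (by positivity)
  have hui : Integrable u μ := DePascale.integrable_of_bdd μ hum huM
  have hu0 : 0 ≤ ∫ x, u x ∂μ := by
    have := humax (fun _ => 0) measurable_const (by intro x; simp; positivity) (by simp)
    simpa using this
  have hD : DePascale.DualBound N μ (N * ∫ x, u x ∂μ) := by
    rintro w hw ⟨B, hB⟩ hwf
    refine mul_le_mul_of_nonneg_left ?_ hNpos.le
    by_cases hw0 : 0 ≤ ∫ x, w x ∂μ
    · have hup := DePascale.apriori (by omega) μ r hr hb w hw B hB hwf hw0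
      let w' : EuclideanSpace ℝ (Fin d) → ℝ := fun x => max (w x) (-((N - 1) * A))
      have hN1 : (1 : ℝ) ≤ N := by exact_mod_cast (by omega : 1 ≤ N)
      have hw'm : Measurable w' := hw.max measurable_const
      have hw'up : ∀ x, w' x ≤ A := fun x => max_le (hup x) (by nlinarith)
      have hw'b : ∀ x, |w' x| ≤ N * A := by
        intro x
        have h1 : -((N - 1) * A) ≤ w' x := le_max_right _ _
        rw [abs_le]
        constructor
        · nlinarith
        · nlinarith [hw'up x]
      have hw'f : ∀ x : Fin N → EuclideanSpace ℝ (Fin d),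
          ENNReal.ofReal (∑ i, w' (x i)) ≤ coulomb x := by
        intro x
        by_cases hall : ∀ i, w' (x i) = w (x i)
        · simp only [hall]; exact hwf x
        · push Not at hall
          obtain ⟨i, hi⟩ := hall
          have hi' : w' (x i) = -((N - 1) * A) := by
            rcases max_choice (w (x i)) (-((N - 1) * A)) with h | h
            · exact absurd h hi
            · exact h
          have hs : ∑ i, w' (x i) ≤ 0 := by
            rw [← Finset.add_sum_erase Finset.univ _ (Finset.mem_univ i), hi']
            have h2 : ∑ j ∈ Finset.univ.erase i, w' (x j) ≤ ∑ j ∈ Finset.univ.erase i, A :=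
              Finset.sum_le_sum fun j _ => hw'up _
            rw [Finset.sum_const, Finset.card_erase_of_mem (Finset.mem_univ i), Finset.card_univ,
              Fintype.card_fin, nsmul_eq_mul, Nat.cast_sub (by omega)] at h2
            push_cast at h2
            linarith
          rw [ENNReal.ofReal_of_nonpos hs]
          exact zero_le
      refine le_trans ?_ (humax w' hw'm hw'b (Filter.Eventually.of_forall hw'f))
      exact integral_mono (DePascale.integrable_of_bdd μ hw hB)
        (DePascale.integrable_of_bdd μ hw'm hw'b) fun x => le_max_left _ _
    · linarith
  obtain ⟨γ, hγp, hγm, hγc⟩ := DePascale.exists_plan (by omega) μ hD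
  refine ⟨u, hum, hui, ⟨_, huM⟩, huf, ?_, ?_, ?_⟩
  · intro v hv hvf
    have := (DePascale.weak_duality μ v hv hvf γ hγm).trans hγc
    exact (ENNReal.ofReal_le_ofReal_iff (by positivity)).1 this
  · exact ⟨γ, hγp, hγm, le_antisymm (DePascale.weak_duality μ u hui huf γ hγm) hγc⟩
  · rintro _ ⟨γ', -, hm', rfl⟩
    exact DePascale.weak_duality μ u hui huf γ' hm'
end

section
/- Let μ be a Borel probability measure on ℝ^d, absolutely continuous with respect to Lebesgue measure, such that the minimum of ∫ 1/|x₁ − x₂| dγ over couplings γ ∈ Π₂(μ) is finite. Then this problem admits a unique minimizer γ_O ∈ Π₂(μ), and γ_O is deterministic: there exists a Borel map T : ℝ^d → ℝ^d with T_♯ μ = μ such that γ_O = (Id, T)_♯ μ. -/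
open MeasureTheory ENNReal

/-- The two-marginal Coulomb cost on `ℝ^d × ℝ^d`, with value `+∞` on the diagonal. -/
noncomputable def coulomb2 {d : ℕ} (p : EuclideanSpace ℝ (Fin d) × EuclideanSpace ℝ (Fin d)) :
    ℝ≥0∞ :=
  (ENNReal.ofReal ‖p.1 - p.2‖)⁻¹

open Filter Topology Set

/-- `γ` is a coupling of `μ` with itself. -/
structure IsCpl {d : ℕ} (μ : Measure (EuclideanSpace ℝ (Fin d)))
    (γ : Measure (EuclideanSpace ℝ (Fin d) × EuclideanSpace ℝ (Fin d))) : Prop where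
  prob : IsProbabilityMeasure γ
  fst : γ.map Prod.fst = μ
  snd : γ.map Prod.snd = μ

/-- `γ` is an optimal coupling. -/
def IsOpt {d : ℕ} (μ : Measure (EuclideanSpace ℝ (Fin d)))
    (γ : Measure (EuclideanSpace ℝ (Fin d) × EuclideanSpace ℝ (Fin d))) : Prop :=
  ∀ γ', IsCpl μ γ' → ∫⁻ p, coulomb2 p ∂γ ≤ ∫⁻ p, coulomb2 p ∂γ'

lemma continuous_coulomb2 {d : ℕ} : Continuous (coulomb2 (d := d)) := by
  unfold coulomb2
  exact (ENNReal.continuous_ofReal.comp (by fun_prop)).inv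

lemma measurable_coulomb2 {d : ℕ} : Measurable (coulomb2 (d := d)) :=
  continuous_coulomb2.measurable

/-- The cost is lower semicontinuous for weak convergence. -/
lemma lsc_cost {d : ℕ} : LowerSemicontinuous
    (fun γ : ProbabilityMeasure (EuclideanSpace ℝ (Fin d) × EuclideanSpace ℝ (Fin d)) =>
      ∫⁻ p, coulomb2 p ∂(γ : Measure (EuclideanSpace ℝ (Fin d) × EuclideanSpace ℝ (Fin d)))) := by
  have key : ∀ γ : ProbabilityMeasure (EuclideanSpace ℝ (Fin d) × EuclideanSpace ℝ (Fin d)),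
      ∫⁻ p, coulomb2 p ∂(γ : Measure (EuclideanSpace ℝ (Fin d) × EuclideanSpace ℝ (Fin d))) =
        ⨆ n : ℕ, ∫⁻ p, min (coulomb2 p) n
          ∂(γ : Measure (EuclideanSpace ℝ (Fin d) × EuclideanSpace ℝ (Fin d))) := by
    intro γ
    rw [← lintegral_iSup]
    · congr 1
      ext p
      rw [← inf_iSup_eq, ENNReal.iSup_natCast, inf_top_eq]
    · intro n
      exact measurable_coulomb2.min measurable_const
    · intro m n h p
      exact min_le_min le_rfl (by exact_mod_cast h)
  simp_rw [key]
  refine lowerSemicontinuous_iSup fun n => Continuous.lowerSemicontinuous ?_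
  have hne : ∀ p : EuclideanSpace ℝ (Fin d) × EuclideanSpace ℝ (Fin d),
      min (coulomb2 p) (n : ℝ≥0∞) ≠ ⊤ := fun p =>
    ne_top_of_le_ne_top (ENNReal.natCast_ne_top n) (min_le_right _ _)
  have hc : Continuous fun p : EuclideanSpace ℝ (Fin d) × EuclideanSpace ℝ (Fin d) =>
      (min (coulomb2 p) (n : ℝ≥0∞)).toNNReal := by
    rw [continuous_iff_continuousAt]
    intro p
    exact (ENNReal.tendsto_toNNReal (hne p)).comp
      (continuous_coulomb2.min continuous_const).continuousAt
  have hle : ∀ p : EuclideanSpace ℝ (Fin d) × EuclideanSpace ℝ (Fin d),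
      (min (coulomb2 p) (n : ℝ≥0∞)).toNNReal ≤ n := by
    intro p
    have := ENNReal.toNNReal_mono (ENNReal.natCast_ne_top n) (min_le_right (coulomb2 p) (n : ℝ≥0∞))
    simpa using this
  let f : BoundedContinuousFunction (EuclideanSpace ℝ (Fin d) × EuclideanSpace ℝ (Fin d)) NNReal :=
    BoundedContinuousFunction.mkOfBound ⟨_, hc⟩ n (by
      intro p q
      rw [NNReal.dist_eq]
      have h1 : ((min (coulomb2 p) (n : ℝ≥0∞)).toNNReal : ℝ) ≤ n := by exact_mod_cast hle p
      have h2 : ((min (coulomb2 q) (n : ℝ≥0∞)).toNNReal : ℝ) ≤ n := by exact_mod_cast hle q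
      have h3 := ((min (coulomb2 p) (n : ℝ≥0∞)).toNNReal).coe_nonneg
      have h4 := ((min (coulomb2 q) (n : ℝ≥0∞)).toNNReal).coe_nonneg
      exact abs_le.2 ⟨by simp only [ContinuousMap.coe_mk]; linarith,
        by simp only [ContinuousMap.coe_mk]; linarith⟩)
  have := ProbabilityMeasure.continuous_lintegral_boundedContinuousFunction f
  refine this.congr fun γ => ?_
  refine lintegral_congr fun p => ?_
  exact ENNReal.coe_toNNReal (hne p)

/-- Existence of an optimal coupling. -/
lemma exists_opt {d : ℕ} (μ : Measure (EuclideanSpace ℝ (Fin d))) [IsProbabilityMeasure μ]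
    (γ₀ : Measure (EuclideanSpace ℝ (Fin d) × EuclideanSpace ℝ (Fin d))) (h₀ : IsCpl μ γ₀) :
    ∃ γ, IsCpl μ γ ∧ IsOpt μ γ := by
  let P : ProbabilityMeasure (EuclideanSpace ℝ (Fin d)) := ⟨μ, inferInstance⟩
  let S : Set (ProbabilityMeasure (EuclideanSpace ℝ (Fin d) × EuclideanSpace ℝ (Fin d))) :=
    {γ | γ.map measurable_fst.aemeasurable = P} ∩ {γ | γ.map measurable_snd.aemeasurable = P}
  have hS : ∀ γ, γ ∈ S ↔ IsCpl μ (γ : Measure _) := by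
    intro γ
    constructor
    · rintro ⟨h1, h2⟩
      exact ⟨inferInstance, congrArg Subtype.val h1,
        congrArg Subtype.val h2⟩
    · intro h
      exact ⟨Subtype.ext h.fst, Subtype.ext h.snd⟩
  have hcl : IsClosed S :=
    (isClosed_eq (ProbabilityMeasure.continuous_map continuous_fst) continuous_const).inter
    (isClosed_eq (ProbabilityMeasure.continuous_map continuous_snd) continuous_const)
  have hcomp : IsCompact S := by
    rw [← hcl.closure_eq]
    apply isCompact_closure_of_isTightMeasureSet
    apply IsTightMeasureSet.prodMk
    · refine IsTightMeasureSet.subset (isTightMeasureSet_singleton (μ := μ)) ?_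
      rintro _ ⟨_, ⟨γ, hγ, rfl⟩, rfl⟩
      exact ((hS γ).1 hγ).fst
    · refine IsTightMeasureSet.subset (isTightMeasureSet_singleton (μ := μ)) ?_
      rintro _ ⟨_, ⟨γ, hγ, rfl⟩, rfl⟩
      exact ((hS γ).1 hγ).snd
  have hne : S.Nonempty := ⟨⟨γ₀, h₀.prob⟩, (hS _).2 h₀⟩
  obtain ⟨γ, hγ, hmin⟩ := LowerSemicontinuousOn.exists_isMinOn hne hcomp
    ((lsc_cost (d := d)).lowerSemicontinuousOn S)
  refine ⟨γ, (hS γ).1 hγ, fun γ' h' => ?_⟩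
  exact hmin ((hS ⟨γ', h'.prob⟩).2 h')

/-- A swap decreasing the cost contradicts optimality: 2-monotonicity of the support. -/
lemma two_monotone {d : ℕ} {μ : Measure (EuclideanSpace ℝ (Fin d))}
    {γ : Measure (EuclideanSpace ℝ (Fin d) × EuclideanSpace ℝ (Fin d))} (hγ : IsCpl μ γ)
    (ho : IsOpt μ γ) (hfin : ∫⁻ p, coulomb2 p ∂γ ≠ ⊤)
    {p q : EuclideanSpace ℝ (Fin d) × EuclideanSpace ℝ (Fin d)}
    (hp : p ∈ γ.support) (hq : q ∈ γ.support) :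
    coulomb2 p + coulomb2 q ≤ coulomb2 (p.1, q.2) + coulomb2 (q.1, p.2) := by
  have := hγ.prob
  by_contra! hlt
  obtain ⟨r, hr1, hr2⟩ := exists_between hlt
  obtain ⟨s, hs1, hs2⟩ := exists_between hr2
  let X := EuclideanSpace ℝ (Fin d)
  have hcA : Continuous fun z : (X × X) × (X × X) => coulomb2 z.1 + coulomb2 z.2 :=
    (continuous_coulomb2.comp continuous_fst).add (continuous_coulomb2.comp continuous_snd)
  have hcB : Continuous fun z : (X × X) × (X × X) =>
      coulomb2 (z.1.1, z.2.2) + coulomb2 (z.2.1, z.1.2) :=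
    (continuous_coulomb2.comp (by fun_prop)).add (continuous_coulomb2.comp (by fun_prop))
  have hU : {z : (X × X) × (X × X) | s < coulomb2 z.1 + coulomb2 z.2 ∧
      coulomb2 (z.1.1, z.2.2) + coulomb2 (z.2.1, z.1.2) < r} ∈ 𝓝 (p, q) :=
    ((isOpen_lt continuous_const hcA).inter (isOpen_lt hcB continuous_const)).mem_nhds
      ⟨hs2, hr1⟩
  rw [nhds_prod_eq, Filter.mem_prod_iff] at hU
  obtain ⟨A', hA', B', hB', hAB⟩ := hU
  obtain ⟨A, hAA, hAo, hpA⟩ := mem_nhds_iff.1 hA'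
  obtain ⟨B, hBB, hBo, hqB⟩ := mem_nhds_iff.1 hB'
  have hγA : 0 < γ A := (Measure.mem_support_iff_forall p).1 hp A (hAo.mem_nhds hpA)
  have hγB : 0 < γ B := (Measure.mem_support_iff_forall q).1 hq B (hBo.mem_nhds hqB)
  let Q := (γ.restrict A).prod (γ.restrict B)
  have hQae : ∀ᵐ z ∂Q, s < coulomb2 z.1 + coulomb2 z.2 ∧
      coulomb2 (z.1.1, z.2.2) + coulomb2 (z.2.1, z.1.2) < r := by
    have : Q = (γ.prod γ).restrict (A ×ˢ B) := Measure.prod_restrict A B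
    rw [this]
    refine (ae_restrict_iff' (hAo.measurableSet.prod hBo.measurableSet)).2 ?_
    exact Eventually.of_forall fun z hz => hAB ⟨hAA hz.1, hBB hz.2⟩
  have hQu : Q univ = γ A * γ B := by
    simp [Q, Measure.prod_apply MeasurableSet.univ, mul_comm]
  have hQ0 : Q univ ≠ 0 := by
    rw [hQu]; exact mul_ne_zero hγA.ne' hγB.ne'
  have hQt : Q univ ≠ ⊤ := measure_ne_top _ _
  let σ : Measure (X × X) := (2⁻¹ : ℝ≥0∞) • (Q.map Prod.fst + Q.map Prod.snd)
  let τ : Measure (X × X) := (2⁻¹ : ℝ≥0∞) •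
    (Q.map (fun z => (z.1.1, z.2.2)) + Q.map (fun z => (z.2.1, z.1.2)))
  have hfstle : Q.map Prod.fst ≤ γ := by
    have : Q.map Prod.fst = (γ.restrict B univ) • γ.restrict A := Measure.map_fst_prod
    rw [this]
    refine Measure.le_iff.2 fun t _ => ?_
    rw [Measure.smul_apply, smul_eq_mul, Measure.restrict_apply_univ]
    calc γ B * γ.restrict A t ≤ 1 * γ t := mul_le_mul' prob_le_one (Measure.restrict_le_self t)
      _ = γ t := one_mul _
  have hsndle : Q.map Prod.snd ≤ γ := by
    have : Q.map Prod.snd = (γ.restrict A univ) • γ.restrict B := Measure.map_snd_prod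
    rw [this]
    refine Measure.le_iff.2 fun t _ => ?_
    rw [Measure.smul_apply, smul_eq_mul, Measure.restrict_apply_univ]
    calc γ A * γ.restrict B t ≤ 1 * γ t := mul_le_mul' prob_le_one (Measure.restrict_le_self t)
      _ = γ t := one_mul _
  have hσle : σ ≤ γ := by
    refine Measure.le_iff.2 fun t _ => ?_
    simp only [σ, Measure.smul_apply, Measure.add_apply, smul_eq_mul]
    calc (2⁻¹ : ℝ≥0∞) * (Q.map Prod.fst t + Q.map Prod.snd t) ≤ 2⁻¹ * (γ t + γ t) := by
          gcongr
      _ = γ t := by rw [← two_mul, ← mul_assoc, ENNReal.inv_mul_cancel (by simp) (by simp), one_mul]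
  have : IsFiniteMeasure σ := isFiniteMeasure_of_le γ hσle
  have hsub : γ - σ + σ = γ := Measure.sub_add_cancel_of_le hσle
  have hm : ∀ f : X × X → X, Measurable f → σ.map f = τ.map f → (γ - σ + τ).map f = γ.map f := by
    intro f hf h
    rw [Measure.map_add _ _ hf, ← h, ← Measure.map_add _ _ hf, hsub]
  have h1 : σ.map Prod.fst = τ.map Prod.fst := by
    simp only [σ, τ, Measure.map_smul, Measure.map_add _ _ measurable_fst]
    rw [Measure.map_map (by fun_prop) (by fun_prop), Measure.map_map (by fun_prop) (by fun_prop),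
      Measure.map_map (by fun_prop) (by fun_prop), Measure.map_map (by fun_prop) (by fun_prop)]
    rfl
  have h2 : σ.map Prod.snd = τ.map Prod.snd := by
    simp only [σ, τ, Measure.map_smul, Measure.map_add _ _ measurable_snd]
    rw [Measure.map_map (by fun_prop) (by fun_prop), Measure.map_map (by fun_prop) (by fun_prop),
      Measure.map_map (by fun_prop) (by fun_prop), Measure.map_map (by fun_prop) (by fun_prop),
      add_comm]
    rfl
  have hcpl : IsCpl μ (γ - σ + τ) := by
    have hf : (γ - σ + τ).map Prod.fst = μ := (hm _ measurable_fst h1).trans hγ.fst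
    have hs : (γ - σ + τ).map Prod.snd = μ := (hm _ measurable_snd h2).trans hγ.snd
    refine ⟨⟨?_⟩, hf, hs⟩
    have e1 : (γ - σ + τ).map Prod.fst univ = 1 := by
      rw [hf, ← hγ.fst, Measure.map_apply measurable_fst MeasurableSet.univ]
      simp
    rwa [Measure.map_apply measurable_fst MeasurableSet.univ, preimage_univ] at e1
  have hle := ho _ hcpl
  have hγσ : ∫⁻ p, coulomb2 p ∂γ = ∫⁻ p, coulomb2 p ∂(γ - σ) + ∫⁻ p, coulomb2 p ∂σ := by
    rw [← lintegral_add_measure, hsub]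
  rw [lintegral_add_measure, hγσ] at hle
  rw [hγσ] at hfin
  have hle' : ∫⁻ p, coulomb2 p ∂σ ≤ ∫⁻ p, coulomb2 p ∂τ :=
    (ENNReal.add_le_add_iff_left (ENNReal.add_ne_top.1 hfin).1).1 hle
  have hσi : ∫⁻ p, coulomb2 p ∂σ = 2⁻¹ * ∫⁻ z, (coulomb2 z.1 + coulomb2 z.2) ∂Q := by
    simp only [σ]
    rw [lintegral_smul_measure, lintegral_add_measure,
      lintegral_map measurable_coulomb2 measurable_fst,
      lintegral_map measurable_coulomb2 measurable_snd,
      lintegral_add_left (show Measurable fun z : (X × X) × (X × X) => coulomb2 z.1 from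
        measurable_coulomb2.comp measurable_fst), smul_eq_mul]
  have hτi : ∫⁻ p, coulomb2 p ∂τ =
      2⁻¹ * ∫⁻ z, (coulomb2 (z.1.1, z.2.2) + coulomb2 (z.2.1, z.1.2)) ∂Q := by
    simp only [τ]
    rw [lintegral_smul_measure, lintegral_add_measure,
      lintegral_map measurable_coulomb2 (by fun_prop),
      lintegral_map measurable_coulomb2 (by fun_prop),
      lintegral_add_left (show Measurable fun z : (X × X) × (X × X) => coulomb2 (z.1.1, z.2.2) from
        measurable_coulomb2.comp (by fun_prop)), smul_eq_mul]
  rw [hσi, hτi, ENNReal.mul_le_mul_iff_right (by simp) (by simp)] at hle'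
  have hlow : s * Q univ ≤ ∫⁻ z, (coulomb2 z.1 + coulomb2 z.2) ∂Q := by
    rw [← lintegral_const]
    exact lintegral_mono_ae (hQae.mono fun z hz => hz.1.le)
  have hup : ∫⁻ z, (coulomb2 (z.1.1, z.2.2) + coulomb2 (z.2.1, z.1.2)) ∂Q ≤ r * Q univ := by
    rw [← lintegral_const]
    exact lintegral_mono_ae (hQae.mono fun z hz => hz.2.le)
  have := hlow.trans (hle'.trans hup)
  rw [ENNReal.mul_le_mul_iff_left hQ0 hQt] at this
  exact absurd this (not_le.2 hs1)

lemma hasStrict_inv_norm {d : ℕ} {z : EuclideanSpace ℝ (Fin d)} (hz : z ≠ 0) :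
    HasStrictFDerivAt (fun z : EuclideanSpace ℝ (Fin d) => ‖z‖⁻¹)
      ((-(‖z‖ ^ 3)⁻¹) • (innerSL ℝ z)) z := by
  have hz' : ‖z‖ ≠ 0 := norm_ne_zero_iff.2 hz
  have h1 := (hasStrictFDerivAt_norm_sq z).sqrt (by positivity)
  have h2 : HasStrictFDerivAt (fun z : EuclideanSpace ℝ (Fin d) => ‖z‖) _ z :=
    h1.congr_of_eventuallyEq (Eventually.of_forall fun y => Real.sqrt_sq (norm_nonneg y))
  have h3 := (hasStrictDerivAt_inv hz').comp_hasStrictFDerivAt z h2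
  refine h3.congr_fderiv ?_
  ext w
  simp only [Real.sqrt_sq (norm_nonneg z), FunLike.coe_smul, Pi.smul_apply, smul_eq_mul,
    nsmul_eq_mul]
  simp
  field_simp

/-- The twist condition: the gradient of the cost determines the displacement. -/
lemma twist {d : ℕ} {z w : EuclideanSpace ℝ (Fin d)} (hz : z ≠ 0) (hw : w ≠ 0)
    (h : (-(‖z‖ ^ 3)⁻¹) • (innerSL ℝ z) = (-(‖w‖ ^ 3)⁻¹) • (innerSL ℝ w)) : z = w := by
  have hz' : 0 < ‖z‖ := norm_pos_iff.2 hz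
  have hw' : 0 < ‖w‖ := norm_pos_iff.2 hw
  have h1 : (‖z‖ ^ 3)⁻¹ • z = (‖w‖ ^ 3)⁻¹ • w := by
    refine ext_inner_right ℝ fun v => ?_
    have := congrArg (fun L => L v) h
    simp only [FunLike.coe_smul, Pi.smul_apply, smul_eq_mul, innerSL_apply_apply] at this
    rw [inner_smul_left, inner_smul_left]
    simp only [conj_trivial]
    linarith
  have h2 : (‖z‖ ^ 2)⁻¹ = (‖w‖ ^ 2)⁻¹ := by
    have := congrArg norm h1
    rw [norm_smul, norm_smul, Real.norm_of_nonneg (by positivity),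
      Real.norm_of_nonneg (by positivity)] at this
    field_simp at this ⊢
    linarith
  have h3 : ‖z‖ = ‖w‖ := by
    have := inv_injective h2
    exact (pow_left_inj₀ hz'.le hw'.le two_ne_zero).1 this
  rw [h3] at h1
  exact smul_right_injective _ (by positivity : (‖w‖ ^ 3)⁻¹ ≠ 0) h1

lemma coulomb2_off {d : ℕ} {x y : EuclideanSpace ℝ (Fin d)} (h : x - y ≠ 0) :
    coulomb2 (x, y) = ENNReal.ofReal (‖x - y‖⁻¹) := by
  rw [coulomb2, ENNReal.ofReal_inv_of_pos (norm_pos_iff.2 h)]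

/-- A 2-monotone off-diagonal set is a graph over almost every point. -/
lemma ae_graph {d : ℕ} (Γ : Set (EuclideanSpace ℝ (Fin d) × EuclideanSpace ℝ (Fin d)))
    (hoff : ∀ p ∈ Γ, p.1 ≠ p.2)
    (hmono : ∀ p ∈ Γ, ∀ q ∈ Γ,
      coulomb2 p + coulomb2 q ≤ coulomb2 (p.1, q.2) + coulomb2 (q.1, p.2)) :
    ∀ᵐ x ∂(volume : Measure (EuclideanSpace ℝ (Fin d))),
      ∀ y₀ y₁, (x, y₀) ∈ Γ → (x, y₁) ∈ Γ → y₀ = y₁ := by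
  let X := EuclideanSpace ℝ (Fin d)
  let F : Set X → Set X := fun b => {x | ∃ y ∈ b, (x, y) ∈ Γ}
  have hdens : ∀ᵐ x ∂(volume : Measure X), ∀ b ∈ TopologicalSpace.countableBasis X, x ∈ F b →
      Tendsto (fun r => volume (F b ∩ Metric.closedBall x r) / volume (Metric.closedBall x r))
        (𝓝[>] 0) (𝓝 1) := by
    rw [ae_ball_iff (TopologicalSpace.countable_countableBasis X)]
    intro b _
    exact ae_imp_of_ae_restrict (Besicovitch.ae_tendsto_measure_inter_div volume (F b))
  filter_upwards [hdens] with x hx y₀ y₁ h₀ h₁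
  have hz₀ : x - y₀ ≠ 0 := sub_ne_zero.2 (hoff _ h₀)
  have hz₁ : x - y₁ ≠ 0 := sub_ne_zero.2 (hoff _ h₁)
  set L₀ := (-(‖x - y₀‖ ^ 3)⁻¹) • (innerSL ℝ (x - y₀)) with hL₀
  set L₁ := (-(‖x - y₁‖ ^ 3)⁻¹) • (innerSL ℝ (x - y₁)) with hL₁
  have hd₀ : HasStrictFDerivAt (fun z : X => ‖z‖⁻¹) L₀ (x - y₀) := hasStrict_inv_norm hz₀
  have hd₁ : HasStrictFDerivAt (fun z : X => ‖z‖⁻¹) L₁ (x - y₁) := hasStrict_inv_norm hz₁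
  suffices hL : L₀ = L₁ by
    have := twist hz₀ hz₁ hL
    exact sub_right_injective this
  by_contra hne
  obtain ⟨w, hw⟩ : ∃ w, 0 < (L₀ - L₁) w := by
    by_contra! hcon
    apply hne
    rw [← sub_eq_zero]
    ext w
    have a1 := hcon w
    have a2 := hcon (-w)
    rw [map_neg] at a2
    exact le_antisymm a1 (by simpa using a2)
  set L := L₀ - L₁ with hLdef
  set R := ‖w‖ + 1 with hR
  have hRpos : 0 < R := by positivity
  set η := L w / (4 * R) with hη
  have hηpos : 0 < η := by positivity
  let t : Set X := {u | 2 * η * ‖u‖ < L u} ∩ Metric.ball 0 R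
  have ht : IsOpen t :=
    (isOpen_lt (by fun_prop) L.continuous).inter Metric.isOpen_ball
  have hwt : w ∈ t := by
    refine ⟨?_, by simp [hR]⟩
    have : 2 * η * ‖w‖ = L w * (‖w‖ / (2 * R)) := by rw [hη]; field_simp; norm_num
    show 2 * η * ‖w‖ < L w
    rw [this]
    have h2 : ‖w‖ / (2 * R) < 1 := by
      rw [div_lt_one (by positivity)]
      have := norm_nonneg w
      linarith
    calc L w * (‖w‖ / (2 * R)) < L w * 1 := mul_lt_mul_of_pos_left h2 hw
      _ = L w := mul_one _
  have ht0 : (volume : Measure X) t ≠ 0 := (ht.measure_pos volume ⟨w, hwt⟩).ne'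
  have e₀ : ∀ᶠ p : X × X in 𝓝 (x, y₀), p.1 - p.2 ≠ 0 ∧ x - p.2 ≠ 0 ∧
      ‖‖p.1 - p.2‖⁻¹ - ‖x - p.2‖⁻¹ - L₀ ((p.1 - p.2) - (x - p.2))‖ ≤
        η * ‖(p.1 - p.2) - (x - p.2)‖ := by
    have c1 : Continuous fun p : X × X => (p.1 - p.2, x - p.2) := by fun_prop
    have a1 := (c1.tendsto (x, y₀)).eventually (hd₀.isLittleO.def hηpos)
    have a2 : ∀ᶠ p : X × X in 𝓝 (x, y₀), p.1 - p.2 ≠ 0 :=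
      (continuous_fst.sub continuous_snd).continuousAt.eventually_ne hz₀
    have a3 : ∀ᶠ p : X × X in 𝓝 (x, y₀), x - p.2 ≠ 0 :=
      (continuous_const.sub continuous_snd).continuousAt.eventually_ne hz₀
    filter_upwards [a1, a2, a3] with p b1 b2 b3
    exact ⟨b2, b3, b1⟩
  have e₁ : ∀ᶠ x' : X in 𝓝 x, x' - y₁ ≠ 0 ∧
      ‖‖x' - y₁‖⁻¹ - ‖x - y₁‖⁻¹ - L₁ ((x' - y₁) - (x - y₁))‖ ≤
        η * ‖(x' - y₁) - (x - y₁)‖ := by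
    have c1 : Continuous fun x' : X => (x' - y₁, x - y₁) := by fun_prop
    have a1 := (c1.tendsto x).eventually (hd₁.isLittleO.def hηpos)
    have a2 : ∀ᶠ x' : X in 𝓝 x, x' - y₁ ≠ 0 :=
      (continuous_id.sub continuous_const).continuousAt.eventually_ne hz₁
    filter_upwards [a1, a2] with p b1 b2
    exact ⟨b2, b1⟩
  rw [nhds_prod_eq] at e₀
  obtain ⟨pU, hU, pV, hV, hUV⟩ := Filter.eventually_prod_iff.1 e₀
  obtain ⟨ρ, hρ, hball⟩ := Metric.eventually_nhds_iff.1 (hU.and e₁)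
  obtain ⟨b, hb, hyb, hbV⟩ :=
    (TopologicalSpace.isBasis_countableBasis X).mem_nhds_iff.1 hV
  have hxF : x ∈ F b := ⟨y₀, hyb, h₀⟩
  have hev := Measure.eventually_nonempty_inter_smul_of_density_one volume (F b) x
    (hx b hb hxF) t ht.measurableSet ht0
  have hsmall : ∀ᶠ r : ℝ in 𝓝[>] 0, r < ρ / R :=
    nhdsWithin_le_nhds (Iio_mem_nhds (by positivity))
  have hpos : ∀ᶠ r : ℝ in 𝓝[>] 0, 0 < r := self_mem_nhdsWithin
  obtain ⟨r, ⟨x', ⟨y', hy'b, hxy'⟩, hx't⟩, hrρ, hr⟩ := (hev.and (hsmall.and hpos)).exists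
  obtain ⟨x₁, hx₁, u₁, ⟨u, hu, hu₁⟩, hsum⟩ := hx't
  have hx'eq : x' = x + r • u := by
    rw [← hsum, ← hu₁, mem_singleton_iff.1 hx₁]
  rw [hx'eq] at hxy'
  have huR : ‖u‖ < R := by simpa using hu.2
  have hdist : dist (x + r • u) x < ρ := by
    rw [dist_eq_norm, add_sub_cancel_left, norm_smul, Real.norm_of_nonneg hr.le]
    calc r * ‖u‖ ≤ r * R := by gcongr
      _ < ρ / R * R := by gcongr
      _ = ρ := by field_simp
  obtain ⟨hxU, hx1, hest1⟩ := hball hdist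
  obtain ⟨g1, g2, hest0⟩ := hUV hxU (hbV hy'b)
  have hm := hmono _ h₁ _ hxy'
  dsimp only at hm g1 g2 hest0
  rw [coulomb2_off hz₁, coulomb2_off g1, coulomb2_off g2, coulomb2_off hx1,
    ← ENNReal.ofReal_add (by positivity) (by positivity),
    ← ENNReal.ofReal_add (by positivity) (by positivity),
    ENNReal.ofReal_le_ofReal_iff (by positivity)] at hm
  have s0 : (x + r • u - y') - (x - y') = r • u := by abel
  have s1 : (x + r • u - y₁) - (x - y₁) = r • u := by abel
  rw [s0, map_smul, norm_smul, Real.norm_of_nonneg hr.le, smul_eq_mul] at hest0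
  rw [s1, map_smul, norm_smul, Real.norm_of_nonneg hr.le, smul_eq_mul] at hest1
  have k0 := (abs_le.1 (Real.norm_eq_abs _ ▸ hest0)).1
  have k1 := (abs_le.1 (Real.norm_eq_abs _ ▸ hest1)).2
  have hu1 : 2 * η * ‖u‖ < L₀ u - L₁ u := hu.1
  have k2 : r * (2 * η * ‖u‖) < r * (L₀ u - L₁ u) := mul_lt_mul_of_pos_left hu1 hr
  linarith

/-- Optimal couplings are concentrated on graphs. -/
lemma opt_graph {d : ℕ} {μ : Measure (EuclideanSpace ℝ (Fin d))} [IsProbabilityMeasure μ]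
    (hac : μ ≪ volume)
    {γ : Measure (EuclideanSpace ℝ (Fin d) × EuclideanSpace ℝ (Fin d))} (hγ : IsCpl μ γ)
    (ho : IsOpt μ γ) (hfin : ∫⁻ p, coulomb2 p ∂γ ≠ ⊤) :
    ∃ T : EuclideanSpace ℝ (Fin d) → EuclideanSpace ℝ (Fin d), Measurable T ∧
      ∀ᵐ p ∂γ, p.2 = T p.1 := by
  have := hγ.prob
  let X := EuclideanSpace ℝ (Fin d)
  let Γ : Set (X × X) := {p | p ∈ γ.support ∧ p.1 ≠ p.2}
  have hΓ : ∀ᵐ p ∂γ, p ∈ Γ := by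
    filter_upwards [ae_lt_top measurable_coulomb2 hfin, Measure.support_mem_ae (μ := γ)]
      with p h1 h2
    refine ⟨h2, fun h => ?_⟩
    simp [coulomb2, h] at h1
  have hg := hac.ae_le (ae_graph Γ (fun p hp => hp.2)
    (fun p hp q hq => two_monotone hγ ho hfin hp.1 hq.1))
  let κ := γ.condKernel
  have hdis : Measure.compProd μ κ = γ := by
    have h := γ.disintegrate κ
    have h' : γ.fst = μ := hγ.fst
    rwa [h'] at h
  let T : X → X := fun x => ∫ y, y ∂(κ x)
  have hT : Measurable T :=
    (StronglyMeasurable.integral_kernel (f := fun y : X => y) stronglyMeasurable_id).measurable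
  refine ⟨T, hT, ?_⟩
  have hms : MeasurableSet {p : X × X | p.2 = T p.1} :=
    measurableSet_eq_fun measurable_snd (hT.comp measurable_fst)
  rw [← hdis] at hΓ ⊢
  have hΓ' := Measure.ae_ae_of_ae_compProd hΓ
  rw [Measure.ae_compProd_iff hms]
  filter_upwards [hΓ', hg] with x h1 h2
  obtain ⟨y₀, hy₀⟩ := h1.exists
  have h3 : ∀ᵐ y ∂(κ x), y = y₀ := h1.mono fun y hy => h2 _ _ hy hy₀
  have h4 : T x = y₀ := by
    show ∫ y, y ∂(κ x) = y₀
    rw [integral_congr_ae h3]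
    simp
  rw [h4]
  exact h3

lemma eq_map_of_graph {d : ℕ} {μ : Measure (EuclideanSpace ℝ (Fin d))}
    {γ : Measure (EuclideanSpace ℝ (Fin d) × EuclideanSpace ℝ (Fin d))} (hγ : IsCpl μ γ)
    {T : EuclideanSpace ℝ (Fin d) → EuclideanSpace ℝ (Fin d)} (hT : Measurable T)
    (h : ∀ᵐ p ∂γ, p.2 = T p.1) : γ = μ.map (fun x => (x, T x)) := by
  rw [← hγ.fst, Measure.map_map (by fun_prop) measurable_fst]
  conv_lhs => rw [← Measure.map_id (μ := γ)]
  refine Measure.map_congr (h.mono fun p hp => ?_)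
  exact Prod.ext rfl hp

lemma opt_unique {d : ℕ} {μ : Measure (EuclideanSpace ℝ (Fin d))} [IsProbabilityMeasure μ]
    (hac : μ ≪ volume)
    {γ γ' : Measure (EuclideanSpace ℝ (Fin d) × EuclideanSpace ℝ (Fin d))} (hγ : IsCpl μ γ)
    (ho : IsOpt μ γ) (hfin : ∫⁻ p, coulomb2 p ∂γ ≠ ⊤) (hγ' : IsCpl μ γ') (ho' : IsOpt μ γ') :
    γ' = γ := by
  have := hγ.prob
  have := hγ'.prob
  let ν : Measure (EuclideanSpace ℝ (Fin d) × EuclideanSpace ℝ (Fin d)) :=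
    (2⁻¹ : ℝ≥0∞) • (γ + γ')
  have heq : ∫⁻ p, coulomb2 p ∂γ' = ∫⁻ p, coulomb2 p ∂γ := le_antisymm (ho' _ hγ) (ho _ hγ')
  have h2 : ∀ a : ℝ≥0∞, 2⁻¹ * (a + a) = a := fun a => by
    rw [← two_mul, ← mul_assoc, ENNReal.inv_mul_cancel (by simp) (by simp), one_mul]
  have hcost : ∫⁻ p, coulomb2 p ∂ν = ∫⁻ p, coulomb2 p ∂γ := by
    simp only [ν]
    rw [lintegral_smul_measure, lintegral_add_measure, heq, smul_eq_mul, h2]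
  have hm : ∀ m : Measure (EuclideanSpace ℝ (Fin d)), (2⁻¹ : ℝ≥0∞) • (m + m) = m := fun m => by
    ext s _
    rw [Measure.smul_apply, Measure.add_apply, smul_eq_mul, h2]
  have hν : IsCpl μ ν := by
    refine ⟨⟨?_⟩, ?_, ?_⟩
    · simp only [ν, Measure.smul_apply, Measure.add_apply, measure_univ, smul_eq_mul, h2]
    · simp only [ν, Measure.map_smul, Measure.map_add _ _ measurable_fst, hγ.fst, hγ'.fst, hm]
    · simp only [ν, Measure.map_smul, Measure.map_add _ _ measurable_snd, hγ.snd, hγ'.snd, hm]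
  have hoν : IsOpt μ ν := fun γ'' h'' => hcost.trans_le (ho _ h'')
  obtain ⟨T, hT, hg⟩ := opt_graph hac hν hoν (hcost ▸ hfin)
  have hac1 : γ ≪ ν := by
    refine Measure.AbsolutelyContinuous.mk fun s _ hs => ?_
    simp only [ν, Measure.smul_apply, Measure.add_apply, smul_eq_mul] at hs
    simpa using (by simpa using hs : γ s = 0 ∧ γ' s = 0).1
  have hac2 : γ' ≪ ν := by
    refine Measure.AbsolutelyContinuous.mk fun s _ hs => ?_
    simp only [ν, Measure.smul_apply, Measure.add_apply, smul_eq_mul] at hs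
    simpa using (by simpa using hs : γ s = 0 ∧ γ' s = 0).2
  rw [eq_map_of_graph hγ hT (hac1.ae_le hg), eq_map_of_graph hγ' hT (hac2.ae_le hg)]

/-- **Cotar–Friesecke–Klüppelberg**: for an absolutely continuous probability measure `μ` on
`ℝ^d` with finite two-marginal Coulomb transport cost, the problem admits a unique optimal
coupling in `Π₂(μ)`, and it is deterministic, i.e. induced by a Borel map `T` with `T_♯ μ = μ`. -/
theorem coulomb_two_marginal_monge_solution {d : ℕ}
    (μ : Measure (EuclideanSpace ℝ (Fin d))) [IsProbabilityMeasure μ] (hac : μ ≪ volume)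
    (hfin : sInf {r : ℝ≥0∞ |
        ∃ γ : Measure (EuclideanSpace ℝ (Fin d) × EuclideanSpace ℝ (Fin d)),
          IsProbabilityMeasure γ ∧ γ.map Prod.fst = μ ∧ γ.map Prod.snd = μ ∧
          r = ∫⁻ p, coulomb2 p ∂γ} ≠ ⊤) :
    ∃ γO : Measure (EuclideanSpace ℝ (Fin d) × EuclideanSpace ℝ (Fin d)),
      IsProbabilityMeasure γO ∧ γO.map Prod.fst = μ ∧ γO.map Prod.snd = μ ∧
      (∀ γ : Measure (EuclideanSpace ℝ (Fin d) × EuclideanSpace ℝ (Fin d)),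
        IsProbabilityMeasure γ → γ.map Prod.fst = μ → γ.map Prod.snd = μ →
        ∫⁻ p, coulomb2 p ∂γO ≤ ∫⁻ p, coulomb2 p ∂γ) ∧
      (∀ γ : Measure (EuclideanSpace ℝ (Fin d) × EuclideanSpace ℝ (Fin d)),
        IsProbabilityMeasure γ → γ.map Prod.fst = μ → γ.map Prod.snd = μ →
        (∀ γ' : Measure (EuclideanSpace ℝ (Fin d) × EuclideanSpace ℝ (Fin d)),
          IsProbabilityMeasure γ' → γ'.map Prod.fst = μ → γ'.map Prod.snd = μ →
          ∫⁻ p, coulomb2 p ∂γ ≤ ∫⁻ p, coulomb2 p ∂γ') →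
        γ = γO) ∧
      (∃ T : EuclideanSpace ℝ (Fin d) → EuclideanSpace ℝ (Fin d), Measurable T ∧
        μ.map T = μ ∧ γO = μ.map (fun x => (x, T x))) := by
  have hex : ∃ γ₀, IsCpl μ γ₀ ∧ ∫⁻ p, coulomb2 p ∂γ₀ ≠ ⊤ := by
    by_contra! hcon
    apply hfin
    rw [sInf_eq_top]
    rintro r ⟨γ, h1, h2, h3, rfl⟩
    exact hcon γ ⟨h1, h2, h3⟩
  obtain ⟨γ₀, h₀, hf₀⟩ := hex
  obtain ⟨γ, hγ, ho⟩ := exists_opt μ γ₀ h₀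
  have hf : ∫⁻ p, coulomb2 p ∂γ ≠ ⊤ := ne_top_of_le_ne_top hf₀ (ho _ h₀)
  obtain ⟨T, hT, hg⟩ := opt_graph hac hγ ho hf
  have hmap := eq_map_of_graph hγ hT hg
  refine ⟨γ, hγ.prob, hγ.fst, hγ.snd, fun γ' h1 h2 h3 => ho _ ⟨h1, h2, h3⟩,
    fun γ' h1 h2 h3 h4 => opt_unique hac hγ ho hf ⟨h1, h2, h3⟩
      fun γ'' h => h4 γ'' h.prob h.fst h.snd, T, hT, ?_, hmap⟩
  have h := hγ.snd
  rw [hmap, Measure.map_map measurable_snd (by fun_prop)] at h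
  exact h
end

section
/- Let μ be the Lebesgue (uniform) probability measure on [0,1] and let N ≥ 3 be odd, with repulsive harmonic cost c(x₁,…,x_N) = −Σ_{1 ≤ i < j ≤ N} |x_j − x_i|². Then the infimum of ∫ c(x, T(x), T^{(2)}(x), …, T^{(N−1)}(x)) dμ(x) over Borel maps T : [0,1] → [0,1] with T_♯ μ = μ and T^{(N)} = Id μ-a.e. is not attained by any such T that is differentiable almost everywhere. Equivalently, if T : [0,1] → [0,1] is Borel, T_♯ μ = μ, T^{(N)} = Id μ-a.e., and T is differentiable Lebesgue-almost everywhere, then the identity x + T(x) + T^{(2)}(x) + ⋯ + T^{(N−1)}(x) = N/2 fails on a set of positive Lebesgue measure, so T is not an optimal cyclical map. -/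
open MeasureTheory ENNReal

/-- The uniform probability measure on `[0,1]`. -/
noncomputable def unif01 : Measure ℝ := volume.restrict (Set.Icc (0 : ℝ) 1)

/-- The one-dimensional repulsive harmonic cost `c(x₁,…,x_N) = −Σ_{i<j} |x_j − x_i|²`. -/
noncomputable def repulsiveHarmonic1d {N : ℕ} (x : Fin N → ℝ) : ℝ :=
  -∑ i : Fin N, ∑ j ∈ Finset.Ioi i, (x j - x i) ^ 2

instance unif01_prob : IsProbabilityMeasure unif01 := ⟨by simp [unif01]⟩

lemma ae_unif_mem : ∀ᵐ x ∂unif01, x ∈ Set.Icc (0 : ℝ) 1 :=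
  ae_restrict_mem measurableSet_Icc

lemma abs_deriv_eq_one {N : ℕ} (T : ℝ → ℝ) (hT : Measurable T) (hmap : unif01.map T = unif01)
    (hN : 3 ≤ N) (hcyc : ∀ᵐ x ∂unif01, T^[N] x = x)
    (hdiff : ∀ᵐ x ∂unif01, DifferentiableAt ℝ T x) :
    ∀ᵐ x ∂unif01, |deriv T x| = 1 := by
  have hmp : MeasurePreserving T unif01 unif01 := ⟨hT, hmap⟩
  let A : Set ℝ := {x | x ∈ Set.Icc (0 : ℝ) 1 ∧ T x ∈ Set.Icc (0 : ℝ) 1 ∧ T^[N] x = x ∧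
    DifferentiableAt ℝ T x}
  have hAm : MeasurableSet A := by
    refine measurableSet_Icc.inter ((hT measurableSet_Icc).inter (MeasurableSet.inter ?_
      (measurableSet_of_differentiableAt ℝ T)))
    exact measurableSet_eq_fun (hT.iterate N) measurable_id
  have hA : ∀ᵐ x ∂unif01, x ∈ A := by
    filter_upwards [ae_unif_mem, hmp.quasiMeasurePreserving.ae ae_unif_mem, hcyc, hdiff]
      with x h1 h2 h3 h4 using ⟨h1, h2, h3, h4⟩
  have hinj : Set.InjOn T A := by
    intro x hx y hy hxy
    obtain ⟨k, rfl⟩ : ∃ k, N = k + 1 := ⟨N - 1, by omega⟩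
    have h1 := hx.2.2.1
    have h2 := hy.2.2.1
    rw [Function.iterate_succ_apply] at h1 h2
    rw [← h1, ← h2, hxy]
  have key : (fun x => ENNReal.ofReal |deriv T x|) =ᵐ[unif01] fun _ => 1 := by
    refine ae_eq_of_forall_setLIntegral_eq_of_sigmaFinite ?_ measurable_const ?_
    · exact (continuous_abs.measurable.comp (measurable_deriv T)).ennreal_ofReal
    intro s hs _
    have hsA : MeasurableSet (s ∩ A) := hs.inter hAm
    have hae : (s ∩ A : Set ℝ) =ᵐ[unif01] s := by
      filter_upwards [hA] with x hx
      exact propext ⟨fun h => h.1, fun h => ⟨h, hx⟩⟩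
    have hr : unif01.restrict (s ∩ A) = volume.restrict (s ∩ A) := by
      rw [unif01, Measure.restrict_restrict hsA]
      congr 1
      ext x
      exact ⟨fun h => h.1, fun h => ⟨h, h.2.1⟩⟩
    have hi : Set.InjOn T (s ∩ A) := hinj.mono Set.inter_subset_right
    have h1 := lintegral_abs_det_fderiv_eq_addHaar_image (s := s ∩ A) (f := T)
      (f' := fun x => ContinuousLinearMap.toSpanSingleton ℝ (deriv T x)) volume hsA
      (fun x hx => hx.2.2.2.2.hasDerivAt.hasFDerivAt.hasFDerivWithinAt) hi
    have him : MeasurableSet (T '' (s ∩ A)) := hsA.image_of_measurable_injOn hT hi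
    have h2 : volume (T '' (s ∩ A)) = unif01 (T '' (s ∩ A)) := by
      rw [unif01, Measure.restrict_apply him]
      congr 1
      ext x
      constructor
      · rintro ⟨y, hy, rfl⟩
        exact ⟨⟨y, hy, rfl⟩, hy.2.2.1⟩
      · exact fun h => h.1
    have h3 : unif01 (T '' (s ∩ A)) = unif01 s := by
      rw [← hmp.measure_preimage him.nullMeasurableSet]
      refine measure_congr ?_
      filter_upwards [hA] with x hx
      refine propext ⟨?_, fun h => ⟨x, ⟨h, hx⟩, rfl⟩⟩
      rintro ⟨y, hy, hyx⟩
      rw [← hinj hy.2 hx hyx]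
      exact hy.1
    rw [← Measure.restrict_congr_set hae, hr]
    simp only [ContinuousLinearMap.det_toSpanSingleton] at h1
    rw [h1, h2, h3, ← hr, Measure.restrict_congr_set hae]
    simp
  filter_upwards [key] with x hx
  have : ENNReal.ofReal |deriv T x| = 1 := hx
  simpa using this

lemma part_two {N : ℕ} (hodd : Odd N) (hN : 3 ≤ N) (T : ℝ → ℝ) (hT : Measurable T)
    (hmap : unif01.map T = unif01)
    (hcyc : ∀ᵐ x ∂unif01, T^[N] x = x)
    (hdiff : ∀ᵐ x ∂unif01, DifferentiableAt ℝ T x) :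
    ¬ (∀ᵐ x ∂unif01, ∑ i : Fin N, T^[(i : ℕ)] x = (N : ℝ) / 2) := by
  intro hsum
  have hmp : MeasurePreserving T unif01 unif01 := ⟨hT, hmap⟩
  have h1 := abs_deriv_eq_one T hT hmap hN hcyc hdiff
  have hall : ∀ᵐ x ∂unif01, ∀ i : ℕ, DifferentiableAt ℝ T (T^[i] x) ∧ |deriv T (T^[i] x)| = 1 := by
    rw [ae_all_iff]
    intro i
    exact (hmp.iterate i).quasiMeasurePreserving.ae (hdiff.and h1)
  have hne : ∀ᵐ x ∂unif01, x ≠ 0 ∧ x ≠ 1 := by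
    refine ae_restrict_of_ae ?_
    exact (Measure.ae_ne volume 0).and (Measure.ae_ne volume 1)
  obtain ⟨x, hx, hx01, hxn⟩ := (hall.and (ae_unif_mem.and hne)).exists
  have hd : ∀ i : ℕ, ∃ d : ℤ, Odd d ∧ HasDerivAt (T^[i]) (d : ℝ) x := by
    intro i
    induction i with
    | zero => exact ⟨1, odd_one, by simpa using hasDerivAt_id x⟩
    | succ i ih =>
      obtain ⟨d, hdo, hd⟩ := ih
      have hc := (hx i).1.hasDerivAt.comp x hd
      rw [← Function.iterate_succ'] at hc
      rcases (abs_eq zero_le_one).1 (hx i).2 with h | h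
      · exact ⟨d, hdo, by simpa [h] using hc⟩
      · exact ⟨-d, hdo.neg, by simpa [h] using hc⟩
  choose d hdo hd using hd
  have hD : HasDerivAt (fun y => ∑ i : Fin N, T^[(i : ℕ)] y) (∑ i : Fin N, (d i : ℝ)) x :=
    HasDerivAt.fun_sum fun i _ => hd i
  have hD0 : (∑ i : Fin N, (d i : ℝ)) ≠ 0 := by
    have : Odd (∑ i : Fin N, d i) := by
      choose e he using hdo
      have hs : ∑ i : Fin N, d i = 2 * ∑ i : Fin N, e i + N := by
        simp [he, Finset.sum_add_distrib, Finset.mul_sum]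
      rw [hs]
      exact (even_two_mul _).add_odd (by exact_mod_cast hodd)
    intro h
    have h' : (∑ i : Fin N, d i) = 0 := by exact_mod_cast h
    rw [h'] at this
    simp at this
  have hev := hD.eventually_ne (c := (N : ℝ) / 2) hD0
  rw [eventually_nhdsWithin_iff, Metric.eventually_nhds_iff] at hev
  obtain ⟨ε, hε, hev⟩ := hev
  have hxI : 0 < x ∧ x < 1 :=
    ⟨lt_of_le_of_ne hx01.1 (Ne.symm hxn.1), lt_of_le_of_ne hx01.2 hxn.2⟩
  have hnull : unif01 (Set.Ioo x (min 1 (x + ε))) = 0 := by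
    refine measure_mono_null ?_ (ae_iff.1 hsum)
    intro y hy
    have hy2 := lt_min_iff.1 hy.2
    refine hev ?_ (ne_of_gt hy.1)
    rw [Real.dist_eq, abs_lt]
    constructor <;> linarith [hy.1]
  rw [unif01, Measure.restrict_apply measurableSet_Ioo, Set.inter_eq_left.2, Real.volume_Ioo,
    ENNReal.ofReal_eq_zero] at hnull
  · have : x < min 1 (x + ε) := lt_min hxI.2 (by linarith)
    linarith
  · intro y hy
    have hy2 := lt_min_iff.1 hy.2
    exact ⟨by linarith [hy.1], hy2.1.le⟩

lemma cost_identity {N : ℕ} (x : Fin N → ℝ) :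
    ∑ i : Fin N, ∑ j ∈ Finset.Ioi i, (x j - x i) ^ 2 =
      N * ∑ i, x i ^ 2 - (∑ i, x i) ^ 2 := by
  induction N with
  | zero => simp
  | succ n ih =>
    rw [Fin.sum_univ_succ]
    simp only [Fin.sum_Ioi_zero, Fin.sum_Ioi_succ]
    rw [ih (fun i => x i.succ), Fin.sum_univ_succ (fun i => x i ^ 2), Fin.sum_univ_succ x]
    simp only [sub_sq, Finset.sum_add_distrib, Finset.sum_sub_distrib, Finset.sum_const,
      Finset.card_univ, Fintype.card_fin, nsmul_eq_mul, ← Finset.sum_mul, ← Finset.mul_sum]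
    push_cast
    ring

lemma iterate_mem {S : ℝ → ℝ} (hS : Measurable S) (hmap : unif01.map S = unif01) :
    ∀ᵐ x ∂unif01, ∀ i : ℕ, S^[i] x ∈ Set.Icc (0 : ℝ) 1 := by
  rw [ae_all_iff]
  intro i
  exact (MeasurePreserving.iterate ⟨hS, hmap⟩ i).quasiMeasurePreserving.ae ae_unif_mem

/-- squared deviation from flatness -/
noncomputable def dev (N : ℕ) (S : ℝ → ℝ) (x : ℝ) : ℝ :=
  (∑ i : Fin N, S^[(i : ℕ)] x - (N : ℝ) / 2) ^ 2

lemma dev_integrable (N : ℕ) {S : ℝ → ℝ} (hS : Measurable S) (hmap : unif01.map S = unif01) :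
    Integrable (dev N S) unif01 := by
  refine Integrable.of_bound (C := (N : ℝ) ^ 2) ?_ ?_
  · refine Measurable.aestronglyMeasurable ?_
    unfold dev
    exact ((Finset.measurable_sum (Finset.univ : Finset (Fin N))
      fun i _ => hS.iterate (i : ℕ)).sub_const _).pow_const 2
  · filter_upwards [iterate_mem hS hmap] with x hx
    rw [Real.norm_eq_abs, dev, abs_of_nonneg (sq_nonneg _)]
    have h0 : 0 ≤ ∑ i : Fin N, S^[(i : ℕ)] x := Finset.sum_nonneg fun i _ => (hx i).1
    have h1 : ∑ i : Fin N, S^[(i : ℕ)] x ≤ N := by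
      calc _ ≤ ∑ i : Fin N, (1 : ℝ) := Finset.sum_le_sum fun i _ => (hx i).2
        _ = N := by simp
    apply sq_le_sq'
    · linarith
    · linarith

/-- the cost of a flat plan -/
noncomputable def flatCost (N : ℕ) : ℝ :=
  (N : ℝ) * (N * ∫ x, (x - x ^ 2) ∂unif01) - (N : ℝ) ^ 2 / 4

lemma cost_eq (N : ℕ) {S : ℝ → ℝ} (hS : Measurable S) (hmap : unif01.map S = unif01) :
    ∫ x, repulsiveHarmonic1d (fun i : Fin N => S^[(i : ℕ)] x) ∂unif01 =
      ∫ x, dev N S x ∂unif01 + flatCost N := by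
  have hpt : ∀ x, repulsiveHarmonic1d (fun i : Fin N => S^[(i : ℕ)] x) =
      dev N S x + (∑ i : Fin N, (N : ℝ) * (S^[(i : ℕ)] x - (S^[(i : ℕ)] x) ^ 2)
        - (N : ℝ) ^ 2 / 4) := by
    intro x
    rw [repulsiveHarmonic1d, cost_identity, dev, ← Finset.mul_sum, Finset.sum_sub_distrib]
    ring
  have hint : ∀ i : ℕ, Integrable (fun x => S^[i] x - (S^[i] x) ^ 2) unif01 := by
    intro i
    refine Integrable.of_bound (C := 1) ?_ ?_
    · exact ((hS.iterate i).sub ((hS.iterate i).pow_const 2)).aestronglyMeasurable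
    · filter_upwards [iterate_mem hS hmap] with x hx
      rw [Real.norm_eq_abs, abs_le]
      have := hx i
      constructor <;> nlinarith [this.1, this.2]
  have hval : ∀ i : ℕ, ∫ x, (S^[i] x - (S^[i] x) ^ 2) ∂unif01 = ∫ x, (x - x ^ 2) ∂unif01 := by
    intro i
    have hmp : MeasurePreserving (S^[i]) unif01 unif01 := MeasurePreserving.iterate ⟨hS, hmap⟩ i
    have := integral_map (μ := unif01) (φ := S^[i]) (f := fun x : ℝ => x - x ^ 2)
      hmp.measurable.aemeasurable (by fun_prop)
    rw [hmp.map_eq] at this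
    exact this.symm
  have hi2 : ∀ i ∈ (Finset.univ : Finset (Fin N)),
      Integrable (fun x => (N : ℝ) * (S^[(i : ℕ)] x - (S^[(i : ℕ)] x) ^ 2)) unif01 :=
    fun i _ => (hint i).const_mul _
  have hi3 : Integrable (fun x => ∑ i : Fin N, (N : ℝ) * (S^[(i : ℕ)] x - (S^[(i : ℕ)] x) ^ 2))
      unif01 := integrable_finsetSum _ hi2
  have hi4 : Integrable (fun x => ∑ i : Fin N, (N : ℝ) * (S^[(i : ℕ)] x - (S^[(i : ℕ)] x) ^ 2)
      - (N : ℝ) ^ 2 / 4) unif01 := hi3.sub (integrable_const _)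
  simp_rw [hpt]
  rw [integral_add (dev_integrable N hS hmap) hi4,
    integral_sub hi3 (integrable_const _), integral_finsetSum _ hi2]
  simp_rw [integral_const_mul, hval]
  simp [flatCost]

/-- One step of the approximation: shift the first base-`N` digit, act by `S` on the rest. -/
noncomputable def stepMap (N : ℕ) (S : ℝ → ℝ) (x : ℝ) : ℝ :=
  ((((⌊(N : ℝ) * x⌋₊ + 1) % N : ℕ) : ℝ) + S (Int.fract ((N : ℝ) * x))) / N

structure Good (N : ℕ) (S : ℝ → ℝ) (C : ℝ) : Prop where
  meas : Measurable S
  map_eq : unif01.map S = unif01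
  maps : ∀ x ∈ Set.Ico (0 : ℝ) 1, S x ∈ Set.Ico (0 : ℝ) 1
  cyc : ∀ x ∈ Set.Ico (0 : ℝ) 1, S^[N] x = x
  bound : ∀ x ∈ Set.Ico (0 : ℝ) 1, |∑ i : Fin N, S^[(i : ℕ)] x - (N : ℝ) / 2| ≤ C

lemma unif_Ico : unif01 = volume.restrict (Set.Ico (0 : ℝ) 1) := by
  rw [unif01]; exact Measure.restrict_congr_set Ico_ae_eq_Icc.symm

lemma ae_Ico : ∀ᵐ x ∂unif01, x ∈ Set.Ico (0 : ℝ) 1 := by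
  rw [unif_Ico]; exact ae_restrict_mem measurableSet_Ico

lemma branch_floor {N : ℕ} (hN : 0 < N) (k : ℕ) {u : ℝ} (hu : u ∈ Set.Ico (0 : ℝ) 1) :
    ⌊(N : ℝ) * ((k + u) / N)⌋₊ = k ∧ Int.fract ((N : ℝ) * ((k + u) / N)) = u := by
  have hN' : (N : ℝ) ≠ 0 := by positivity
  rw [mul_div_cancel₀ _ hN']
  constructor
  · rw [Nat.floor_eq_iff (by linarith [hu.1, (Nat.cast_nonneg k : (0 : ℝ) ≤ k)])]
    constructor <;> linarith [hu.1, hu.2]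
  · rw [Int.fract_natCast_add]
    exact Int.fract_eq_self.2 hu

lemma branch_exists {N : ℕ} (hN : 0 < N) {x : ℝ} (hx : x ∈ Set.Ico (0 : ℝ) 1) :
    ∃ k < N, ∃ u ∈ Set.Ico (0 : ℝ) 1, x = ((k : ℝ) + u) / N := by
  have hN' : (0 : ℝ) < N := by positivity
  have h0 : 0 ≤ (N : ℝ) * x := mul_nonneg hN'.le hx.1
  refine ⟨⌊(N : ℝ) * x⌋₊, ?_, N * x - ⌊(N : ℝ) * x⌋₊, ⟨?_, ?_⟩, ?_⟩
  · rw [Nat.floor_lt h0]; nlinarith [hx.2]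
  · linarith [Nat.floor_le h0]
  · linarith [Nat.lt_floor_add_one ((N : ℝ) * x)]
  · field_simp; ring

lemma branch_mem {N : ℕ} {k : ℕ} (hk : k < N) {u : ℝ} (hu : u ∈ Set.Ico (0 : ℝ) 1) :
    ((k : ℝ) + u) / N ∈ Set.Ico (0 : ℝ) 1 := by
  have hN' : (0 : ℝ) < N := by exact_mod_cast (by omega : 0 < N)
  have : (k : ℝ) + 1 ≤ N := by exact_mod_cast hk
  constructor
  · exact div_nonneg (by linarith [hu.1, (Nat.cast_nonneg k : (0 : ℝ) ≤ k)]) hN'.le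
  · rw [div_lt_one hN']; linarith [hu.2]

lemma step_branch {N : ℕ} (hN : 0 < N) (S : ℝ → ℝ) (k : ℕ) {u : ℝ}
    (hu : u ∈ Set.Ico (0 : ℝ) 1) :
    stepMap N S ((k + u) / N) = (((k + 1) % N : ℕ) + S u) / N := by
  obtain ⟨h1, h2⟩ := branch_floor hN k hu
  rw [stepMap, h1, h2]

lemma iter_mem {S : ℝ → ℝ} (hS : ∀ x ∈ Set.Ico (0 : ℝ) 1, S x ∈ Set.Ico (0 : ℝ) 1) (i : ℕ)
    {u : ℝ} (hu : u ∈ Set.Ico (0 : ℝ) 1) : S^[i] u ∈ Set.Ico (0 : ℝ) 1 :=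
  Set.MapsTo.iterate (s := Set.Ico (0 : ℝ) 1) (fun x hx => hS x hx) i hu

lemma step_iter {N : ℕ} (hN : 0 < N) {S : ℝ → ℝ}
    (hS : ∀ x ∈ Set.Ico (0 : ℝ) 1, S x ∈ Set.Ico (0 : ℝ) 1) {k : ℕ} (hk : k < N) {u : ℝ}
    (hu : u ∈ Set.Ico (0 : ℝ) 1) (i : ℕ) :
    (stepMap N S)^[i] ((k + u) / N) = (((k + i) % N : ℕ) + S^[i] u) / N := by
  induction i with
  | zero => simp [Nat.mod_eq_of_lt hk]
  | succ i ih =>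
    rw [Function.iterate_succ_apply', ih, step_branch hN S _ (iter_mem hS i hu),
      Function.iterate_succ_apply', Nat.mod_add_mod, add_assoc]

lemma branch_sum {N : ℕ} (hN : 0 < N) :
    ∑ d : Fin N, unif01.map (fun u : ℝ => ((d : ℕ) + u) / N) = (N : ℝ≥0∞) • unif01 := by
  have hN' : (0 : ℝ) < N := by positivity
  have hbr : ∀ d : Fin N, unif01.map (fun u : ℝ => ((d : ℕ) + u) / N) =
      (N : ℝ≥0∞) • volume.restrict (Set.Ico ((d : ℕ) / (N : ℝ)) (((d : ℕ) + 1) / (N : ℝ))) := by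
    intro d
    have hm : Measurable (fun u : ℝ => ((d : ℕ) + u) / N) := by fun_prop
    have hpre : (fun u : ℝ => ((d : ℕ) + u) / N) ⁻¹'
        (Set.Ico ((d : ℕ) / (N : ℝ)) (((d : ℕ) + 1) / (N : ℝ))) = Set.Ico 0 1 := by
      ext u
      simp only [Set.mem_preimage, Set.mem_Ico, div_le_div_iff_of_pos_right hN',
        div_lt_div_iff_of_pos_right hN']
      constructor <;> rintro ⟨h1, h2⟩ <;> constructor <;> linarith
    rw [unif_Ico, ← hpre, ← Measure.restrict_map hm measurableSet_Ico]
    have : volume.map (fun u : ℝ => ((d : ℕ) + u) / N) = (N : ℝ≥0∞) • volume := by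
      ext s hs
      rw [Measure.map_apply hm hs]
      have : (fun u : ℝ => ((d : ℕ) + u) / N) ⁻¹' s =
          (fun u : ℝ => ((d : ℕ) : ℝ) + u) ⁻¹' ((fun u : ℝ => (N : ℝ)⁻¹ * u) ⁻¹' s) := by
        ext u; simp [div_eq_inv_mul]
      rw [this, measure_preimage_add, Real.volume_preimage_mul_left (by positivity)]
      simp
    rw [this, Measure.restrict_smul]
  simp_rw [hbr]
  rw [← Finset.smul_sum, ← Measure.sum_fintype, ← Measure.restrict_iUnion, unif_Ico]
  · congr 2
    ext x
    simp only [Set.mem_iUnion]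
    constructor
    · rintro ⟨d, hd⟩
      rw [Set.mem_Ico, div_le_iff₀ hN', lt_div_iff₀ hN'] at hd
      have : ((d : ℕ) : ℝ) + 1 ≤ N := by exact_mod_cast d.2
      have h0 : (0 : ℝ) ≤ (d : ℕ) := Nat.cast_nonneg _
      constructor <;> nlinarith [hd.1, hd.2]
    · intro hx
      obtain ⟨k, hk, u, hu, rfl⟩ := branch_exists hN hx
      refine ⟨⟨k, hk⟩, ?_⟩
      simp only [Set.mem_Ico, div_le_div_iff_of_pos_right hN', div_lt_div_iff_of_pos_right hN']
      constructor <;> linarith [hu.1, hu.2]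
  · intro a b hab
    rw [Function.onFun, Set.disjoint_left]
    intro x hxa hxb
    apply hab
    rw [Set.mem_Ico, div_le_iff₀ hN', lt_div_iff₀ hN'] at hxa hxb
    have h1 : ((a : ℕ) : ℝ) < (b : ℕ) + 1 := by linarith
    have h2 : ((b : ℕ) : ℝ) < (a : ℕ) + 1 := by linarith
    have h1' : (a : ℕ) < b + 1 := by exact_mod_cast h1
    have h2' : (b : ℕ) < a + 1 := by exact_mod_cast h2
    ext; omega
  · intro i; exact measurableSet_Ico

lemma step_measurable (N : ℕ) {S : ℝ → ℝ} (hS : Measurable S) : Measurable (stepMap N S) := by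
  unfold stepMap
  have h1 : Measurable (fun x : ℝ => (N : ℝ) * x) := by fun_prop
  have h2 : Measurable (fun k : ℕ => (((k + 1) % N : ℕ) : ℝ)) := measurable_from_top
  exact ((h2.comp (Nat.measurable_floor.comp h1)).add
    (hS.comp (measurable_fract.comp h1))).div_const _

lemma step_map {N : ℕ} (hN : 0 < N) {S : ℝ → ℝ} (hS : Measurable S)
    (hmap : unif01.map S = unif01) : unif01.map (stepMap N S) = unif01 := by
  have : NeZero N := ⟨by omega⟩
  have hm := step_measurable N hS
  have hb : ∀ d : ℕ, Measurable (fun u : ℝ => ((d : ℕ) + u) / (N : ℝ)) := fun d => by fun_prop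
  have h : (N : ℝ≥0∞) • unif01.map (stepMap N S) = (N : ℝ≥0∞) • unif01 := by
    rw [← Measure.map_smul, ← branch_sum hN, Measure.map_finset_sum hm.aemeasurable]
    rw [← Equiv.sum_comp (Equiv.addRight (1 : Fin N))
      (fun d : Fin N => unif01.map (fun u : ℝ => ((d : ℕ) + u) / (N : ℝ)))]
    refine Finset.sum_congr rfl fun d _ => ?_
    rw [Measure.map_map hm (hb d)]
    conv_rhs => rw [← hmap]
    rw [Measure.map_map (hb _) hS]
    refine Measure.map_congr ?_
    filter_upwards [ae_Ico] with u hu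
    simp only [Function.comp]
    rw [step_branch hN S d hu]
    simp [Fin.val_add]
  ext s hs
  have := congrArg (fun m : Measure ℝ => m s) h
  simp only [Measure.smul_apply, smul_eq_mul] at this
  exact (ENNReal.mul_right_inj (by simp; omega) (by simp)).1 this

lemma sum_mod {N : ℕ} (hN : 0 < N) (k : ℕ) :
    ∑ i : Fin N, (((k + (i : ℕ)) % N : ℕ) : ℝ) = (N : ℝ) * (N - 1) / 2 := by
  have : NeZero N := ⟨by omega⟩
  have h1 : ∑ i : Fin N, (((k + (i : ℕ)) % N : ℕ) : ℝ) = ∑ i : Fin N, ((i : ℕ) : ℝ) := by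
    rw [← Equiv.sum_comp (Equiv.addLeft (Fin.ofNat N k)) (fun d : Fin N => ((d : ℕ) : ℝ))]
    refine Finset.sum_congr rfl fun d _ => ?_
    simp [Fin.val_add]
  rw [h1, Fin.sum_univ_eq_sum_range (fun i => (i : ℝ)) N]
  clear h1 this hN
  induction N with
  | zero => simp
  | succ n ih => rw [Finset.sum_range_succ, ih]; push_cast; ring

lemma good_step {N : ℕ} (hN : 0 < N) {S : ℝ → ℝ} {C : ℝ} (h : Good N S C) :
    Good N (stepMap N S) (C / N) := by
  have hN' : (0 : ℝ) < N := by positivity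
  refine ⟨step_measurable N h.meas, step_map hN h.meas h.map_eq, ?_, ?_, ?_⟩
  · intro x hx
    obtain ⟨k, hk, u, hu, rfl⟩ := branch_exists hN hx
    rw [step_branch hN S k hu]
    exact branch_mem (Nat.mod_lt _ hN) (h.maps u hu)
  · intro x hx
    obtain ⟨k, hk, u, hu, rfl⟩ := branch_exists hN hx
    rw [step_iter hN h.maps hk hu, h.cyc u hu, Nat.add_mod_right, Nat.mod_eq_of_lt hk]
  · intro x hx
    obtain ⟨k, hk, u, hu, rfl⟩ := branch_exists hN hx
    simp_rw [step_iter hN h.maps hk hu]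
    rw [← Finset.sum_div, Finset.sum_add_distrib, sum_mod hN]
    have : ((N : ℝ) * (N - 1) / 2 + ∑ i : Fin N, S^[(i : ℕ)] u) / N - N / 2 =
        (∑ i : Fin N, S^[(i : ℕ)] u - N / 2) / N := by
      field_simp; ring
    rw [this, abs_div, abs_of_pos hN']
    exact div_le_div_of_nonneg_right (h.bound u hu) hN'.le

lemma good_exists {N : ℕ} (hN : 0 < N) (n : ℕ) : ∃ S, Good N S ((N : ℝ) / N ^ n) := by
  have hN' : (0 : ℝ) < N := by positivity
  induction n with
  | zero =>
    refine ⟨id, measurable_id, Measure.map_id, fun x hx => hx, fun x _ => by simp, ?_⟩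
    intro x hx
    simp only [Function.iterate_id, id, Finset.sum_const, Finset.card_univ, Fintype.card_fin,
      nsmul_eq_mul, pow_zero, div_one]
    rw [abs_le]
    constructor <;> nlinarith [hx.1, hx.2]
  | succ n ih =>
    obtain ⟨S, hS⟩ := ih
    refine ⟨stepMap N S, ?_⟩
    · have := good_step hN hS
      rwa [div_div, ← pow_succ] at this

lemma attained_flat {N : ℕ} (hN : 3 ≤ N) {T : ℝ → ℝ} (hT : Measurable T)
    (hmap : unif01.map T = unif01)
    (hopt : ∫ x, repulsiveHarmonic1d (fun i : Fin N => T^[(i : ℕ)] x) ∂unif01 =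
        sInf {r : ℝ | ∃ S : ℝ → ℝ, Measurable S ∧ unif01.map S = unif01 ∧
          (∀ᵐ x ∂unif01, S^[N] x = x) ∧
          r = ∫ x, repulsiveHarmonic1d (fun i : Fin N => S^[(i : ℕ)] x) ∂unif01}) :
    ∀ᵐ x ∂unif01, ∑ i : Fin N, T^[(i : ℕ)] x = (N : ℝ) / 2 := by
  have hnn : ∀ S : ℝ → ℝ, 0 ≤ ∫ x, dev N S x ∂unif01 :=
    fun S => integral_nonneg fun x => sq_nonneg _
  have hle : ∀ n : ℕ, ∫ x, dev N T x ∂unif01 ≤ ((N : ℝ) / N ^ n) ^ 2 := by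
    intro n
    obtain ⟨S, hS⟩ := good_exists (N := N) (by omega) n
    have h1 : ∫ x, repulsiveHarmonic1d (fun i : Fin N => T^[(i : ℕ)] x) ∂unif01 ≤
        ∫ x, repulsiveHarmonic1d (fun i : Fin N => S^[(i : ℕ)] x) ∂unif01 := by
      rw [hopt]
      refine csInf_le ⟨flatCost N, ?_⟩ ⟨S, hS.meas, hS.map_eq, ?_, rfl⟩
      · rintro r ⟨R, hR, hRm, -, rfl⟩
        rw [cost_eq N hR hRm]
        linarith [hnn R]
      · filter_upwards [ae_Ico] with x hx using hS.cyc x hx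
    rw [cost_eq N hT hmap, cost_eq N hS.meas hS.map_eq] at h1
    have h2 : ∫ x, dev N S x ∂unif01 ≤ ∫ x, ((N : ℝ) / N ^ n) ^ 2 ∂unif01 := by
      refine integral_mono_ae (dev_integrable N hS.meas hS.map_eq) (integrable_const _) ?_
      filter_upwards [ae_Ico] with x hx
      rw [dev, ← sq_abs]
      exact pow_le_pow_left₀ (abs_nonneg _) (hS.bound x hx) 2
    simp only [integral_const, probReal_univ, one_smul] at h2
    linarith
  have hlim : Filter.Tendsto (fun n : ℕ => ((N : ℝ) / N ^ n) ^ 2) Filter.atTop (nhds 0) := by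
    have h1 : (1 : ℝ) < N := by exact_mod_cast (by omega : 1 < N)
    have h2 := (tendsto_const_nhds (x := (N : ℝ))).div_atTop (tendsto_pow_atTop_atTop_of_one_lt h1)
    simpa using h2.pow 2
  have h0 : ∫ x, dev N T x ∂unif01 = 0 :=
    le_antisymm (ge_of_tendsto' hlim hle) (hnn T)
  rw [integral_eq_zero_iff_of_nonneg (f := dev N T) (fun x => sq_nonneg _) (dev_integrable N hT hmap)] at h0
  filter_upwards [h0] with x hx
  have : (∑ i : Fin N, T^[(i : ℕ)] x - (N : ℝ) / 2) ^ 2 = 0 := hx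
  have := pow_eq_zero_iff (two_ne_zero) |>.1 this
  linarith

/-- For the uniform measure on `[0,1]` and the repulsive harmonic cost with an odd number
`N ≥ 3` of marginals, the cyclical Monge infimum is not attained by any almost everywhere
differentiable cyclical map; equivalently, no a.e. differentiable cyclical map satisfies the
flat-plan optimality condition `x + T(x) + ⋯ + T^{(N−1)}(x) = N/2` a.e. -/
theorem no_ae_differentiable_optimal_cyclical_map {N : ℕ} [NeZero N]
    (hodd : Odd N) (hN : 3 ≤ N) :
    (¬ ∃ T : ℝ → ℝ, Measurable T ∧ unif01.map T = unif01 ∧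
      (∀ᵐ x ∂unif01, T^[N] x = x) ∧
      (∀ᵐ x ∂unif01, DifferentiableAt ℝ T x) ∧
      ∫ x, repulsiveHarmonic1d (fun i : Fin N => T^[(i : ℕ)] x) ∂unif01 =
        sInf {r : ℝ | ∃ S : ℝ → ℝ, Measurable S ∧ unif01.map S = unif01 ∧
          (∀ᵐ x ∂unif01, S^[N] x = x) ∧
          r = ∫ x, repulsiveHarmonic1d (fun i : Fin N => S^[(i : ℕ)] x) ∂unif01}) ∧
    (∀ T : ℝ → ℝ, Measurable T → unif01.map T = unif01 →
      (∀ᵐ x ∂unif01, T^[N] x = x) →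
      (∀ᵐ x ∂unif01, DifferentiableAt ℝ T x) →
      ¬ (∀ᵐ x ∂unif01, ∑ i : Fin N, T^[(i : ℕ)] x = (N : ℝ) / 2)) := by
  refine ⟨?_, fun T hT hm hc hd => part_two hodd hN T hT hm hc hd⟩
  rintro ⟨T, hT, hm, hc, hd, hopt⟩
  exact part_two hodd hN T hT hm hc hd (attained_flat hN hT hm hopt)
end

section
/- Let μ be a Borel probability measure on ℝ^d. Then lim_{N → ∞} (1 / binom(N,2)) · min_{γ ∈ Π_N(μ)} ∫_{(ℝ^d)^N} Σ_{1 ≤ i < j ≤ N} 1/|x_i − x_j| dγ = ∫_{ℝ^d × ℝ^d} 1/|x − y| d(μ ⊗ μ)(x, y), where both sides are understood as values in [0, +∞]. In other words, the normalized minimal multi-marginal Coulomb transport cost converges, as the number N of marginals tends to infinity, to the mean-field energy E^{MF}(μ) = ∫∫ 1/|x − y| dμ(x) dμ(y). -/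
open MeasureTheory ENNReal

/-- Gaussian kernel. -/
noncomputable def gK {d : ℕ} (s : ℝ) (x y : EuclideanSpace ℝ (Fin d)) : ℝ≥0∞ :=
  ENNReal.ofReal (Real.exp (-(s ^ 2) * ‖x - y‖ ^ 2))

lemma gK_meas {d : ℕ} : Measurable
    (fun q : ℝ × (EuclideanSpace ℝ (Fin d) × EuclideanSpace ℝ (Fin d)) => gK q.1 q.2.1 q.2.2) := by
  unfold gK
  apply ENNReal.measurable_ofReal.comp
  apply Continuous.measurable
  fun_prop

lemma gK_self {d : ℕ} (s : ℝ) (x : EuclideanSpace ℝ (Fin d)) : gK s x x = 1 := by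
  simp [gK]

lemma gK_symm {d : ℕ} (s : ℝ) (x y : EuclideanSpace ℝ (Fin d)) : gK s x y = gK s y x := by
  simp [gK, norm_sub_rev]

lemma gK_le_one {d : ℕ} (s : ℝ) (x y : EuclideanSpace ℝ (Fin d)) : gK s x y ≤ 1 := by
  unfold gK
  rw [← ENNReal.ofReal_one]
  apply ENNReal.ofReal_le_ofReal
  apply Real.exp_le_one_iff.2
  nlinarith [mul_nonneg (sq_nonneg s) (sq_nonneg ‖x - y‖)]

/-- Representation of the Coulomb kernel as a superposition of Gaussians. -/
lemma gK_lintegral {d : ℕ} (x y : EuclideanSpace ℝ (Fin d)) :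
    ∫⁻ s : ℝ, gK s x y = ENNReal.ofReal (√Real.pi) * (ENNReal.ofReal ‖x - y‖)⁻¹ := by
  unfold gK
  have hpi : 0 < √Real.pi := Real.sqrt_pos.2 Real.pi_pos
  rcases (norm_nonneg (x - y)).eq_or_lt with h | h
  · rw [← h]
    simp [ENNReal.mul_top, hpi]
  · have hb : 0 < ‖x - y‖ ^ 2 := by positivity
    have h1 := integrable_exp_neg_mul_sq hb
    have h2 := ofReal_integral_eq_lintegral_ofReal h1
      (Filter.Eventually.of_forall fun s => (Real.exp_pos _).le)
    rw [integral_gaussian, Real.sqrt_div Real.pi_pos.le, Real.sqrt_sq h.le,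
      ENNReal.ofReal_div_of_pos h, ENNReal.div_eq_inv_mul, mul_comm] at h2
    rw [h2]
    congr 1
    ext s
    congr 2
    ring

/-- Factorisation of the Gaussian kernel. -/
lemma gK_factor {d : ℕ} (s : ℝ) (x y : EuclideanSpace ℝ (Fin d)) :
    ∫⁻ z : EuclideanSpace ℝ (Fin d),
      ENNReal.ofReal (Real.exp (-(2 * s ^ 2) * ‖x - z‖ ^ 2)) *
        ENNReal.ofReal (Real.exp (-(2 * s ^ 2) * ‖y - z‖ ^ 2)) =
    (∫⁻ z : EuclideanSpace ℝ (Fin d), ENNReal.ofReal (Real.exp (-(4 * s ^ 2) * ‖z‖ ^ 2))) *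
      gK s x y := by
  rw [← lintegral_sub_right_eq_self (fun z : EuclideanSpace ℝ (Fin d) =>
    ENNReal.ofReal (Real.exp (-(4 * s ^ 2) * ‖z‖ ^ 2))) ((2⁻¹ : ℝ) • (x + y)),
    ← lintegral_mul_const]
  · congr 1
    ext z
    unfold gK
    rw [← ENNReal.ofReal_mul (Real.exp_pos _).le, ← ENNReal.ofReal_mul (Real.exp_pos _).le,
      ← Real.exp_add, ← Real.exp_add]
    congr 2
    have h := parallelogram_law_with_norm ℝ (x - z) (y - z)
    have e1 : x - z + (y - z) = (-2 : ℝ) • (z - (2⁻¹ : ℝ) • (x + y)) := by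
      module
    have e2 : x - z - (y - z) = x - y := by abel
    rw [e1, e2, norm_smul] at h
    have e3 : ‖(-2 : ℝ)‖ = 2 := by norm_num
    rw [e3] at h
    linear_combination (s ^ 2) * h
  · apply ENNReal.measurable_ofReal.comp
    apply Continuous.measurable
    fun_prop

lemma gauss_const {d : ℕ} {s : ℝ} (hs : s ≠ 0) :
    (∫⁻ z : EuclideanSpace ℝ (Fin d), ENNReal.ofReal (Real.exp (-(4 * s ^ 2) * ‖z‖ ^ 2))) ≠ 0 ∧
    (∫⁻ z : EuclideanSpace ℝ (Fin d), ENNReal.ofReal (Real.exp (-(4 * s ^ 2) * ‖z‖ ^ 2))) ≠ ∞ := by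
  have hb : 0 < 4 * s ^ 2 := by positivity
  have h1 := GaussianFourier.integral_rexp_neg_mul_sq_norm (V := EuclideanSpace ℝ (Fin d)) hb
  have hp : 0 < (Real.pi / (4 * s ^ 2)) ^
      (((Module.finrank ℝ (EuclideanSpace ℝ (Fin d)) : ℕ) : ℝ) / 2) :=
    Real.rpow_pos_of_pos (div_pos Real.pi_pos hb) _
  have h2 := ofReal_integral_eq_lintegral_ofReal
    (MeasureTheory.Integrable.of_integral_ne_zero (h1.trans_ne hp.ne'))
    (Filter.Eventually.of_forall fun s => (Real.exp_pos _).le)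
  rw [← h2, h1]
  exact ⟨by simpa using hp, ENNReal.ofReal_ne_top⟩

lemma sq_lintegral_le {α : Type*} [MeasurableSpace α] (γ : Measure α) [IsProbabilityMeasure γ]
    {f : α → ℝ≥0∞} (hf : Measurable f) : (∫⁻ x, f x ∂γ) ^ 2 ≤ ∫⁻ x, f x * f x ∂γ := by
  have h := ENNReal.lintegral_mul_le_Lp_mul_Lq γ Real.HolderConjugate.two_two
    hf.aemeasurable (measurable_const (a := (1 : ℝ≥0∞))).aemeasurable
  simp only [Pi.mul_apply, mul_one, ENNReal.one_rpow, lintegral_one, measure_univ] at h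
  calc (∫⁻ x, f x ∂γ) ^ 2 ≤ ((∫⁻ x, f x ^ (2 : ℝ) ∂γ) ^ (1 / 2 : ℝ)) ^ 2 := by gcongr
    _ = ∫⁻ x, f x ^ (2 : ℝ) ∂γ := by
      rw [← ENNReal.rpow_natCast, ← ENNReal.rpow_mul]; norm_num
    _ = ∫⁻ x, f x * f x ∂γ := by
      congr 1; ext x
      rw [← pow_two, ← ENNReal.rpow_natCast]; norm_num

/-- Cauchy-Schwarz for a product kernel. -/
lemma prod_kernel {E : Type*} [MeasurableSpace E] {N : ℕ} (μ : Measure E) [IsProbabilityMeasure μ]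
    (γ : Measure (Fin N → E)) [IsProbabilityMeasure γ] (hγ : ∀ i, γ.map (fun x => x i) = μ)
    {f : E → ℝ≥0∞} (hf : Measurable f) :
    (N : ℝ≥0∞) ^ 2 * ∫⁻ p, f p.1 * f p.2 ∂(μ.prod μ) ≤
      ∫⁻ x, ∑ i, ∑ j, f (x i) * f (x j) ∂γ := by
  have h := sq_lintegral_le γ (f := fun x => ∑ i, f (x i)) (by fun_prop)
  rw [lintegral_finsetSum _ (by fun_prop)] at h
  have h1 : ∀ i, ∫⁻ x, f (x i) ∂γ = ∫⁻ y, f y ∂μ := by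
    intro i
    rw [← hγ i, lintegral_map hf (by fun_prop)]
  simp only [h1, Finset.sum_const, Finset.card_univ, Fintype.card_fin, nsmul_eq_mul] at h
  rw [lintegral_prod_mul hf.aemeasurable hf.aemeasurable, ← pow_two, ← mul_pow]
  refine h.trans (le_of_eq ?_)
  simp_rw [Finset.sum_mul_sum]

/-- Positivity for kernels that are superpositions of product kernels. -/
lemma kernel_pos {E : Type*} [MeasurableSpace E] {N : ℕ} (ν : Measure E) [SFinite ν]
    (μ : Measure E) [IsProbabilityMeasure μ]
    (γ : Measure (Fin N → E)) [IsProbabilityMeasure γ] (hγ : ∀ i, γ.map (fun x => x i) = μ)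
    (φ : E → E → ℝ≥0∞) (hφm : Measurable (fun q : E × E => φ q.1 q.2))
    (k : E → E → ℝ≥0∞) (K : ℝ≥0∞) (hK0 : K ≠ 0) (hKt : K ≠ ∞)
    (hfac : ∀ x y, ∫⁻ z, φ z x * φ z y ∂ν = K * k x y) :
    (N : ℝ≥0∞) ^ 2 * ∫⁻ p, k p.1 p.2 ∂(μ.prod μ) ≤ ∫⁻ x, ∑ i, ∑ j, k (x i) (x j) ∂γ := by
  have hφm' : ∀ z, Measurable (φ z) := fun z => hφm.comp measurable_prodMk_left
  have main : ∫⁻ z, (N : ℝ≥0∞) ^ 2 * ∫⁻ p, φ z p.1 * φ z p.2 ∂(μ.prod μ) ∂ν ≤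
      ∫⁻ z, ∫⁻ x, ∑ i, ∑ j, φ z (x i) * φ z (x j) ∂γ ∂ν :=
    lintegral_mono fun z => prod_kernel μ γ hγ (hφm' z)
  have hm1 : Measurable (fun q : E × (E × E) => φ q.1 q.2.1 * φ q.1 q.2.2) :=
    (hφm.comp (f := fun q : E × (E × E) => (q.1, q.2.1)) (by fun_prop)).mul
    (hφm.comp (f := fun q : E × (E × E) => (q.1, q.2.2)) (by fun_prop))
  have hm2 : ∀ i j, Measurable (fun q : E × (Fin N → E) => φ q.1 (q.2 i) * φ q.1 (q.2 j)) :=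
    fun i j => hm1.comp (f := fun q : E × (Fin N → E) => (q.1, (q.2 i, q.2 j))) (by fun_prop)
  have hm2' : ∀ (x : Fin N → E) i j, Measurable (fun z => φ z (x i) * φ z (x j)) :=
    fun x i j => (hm2 i j).comp measurable_prodMk_right
  have hm3 : Measurable (fun q : E × (Fin N → E) => ∑ i, ∑ j, φ q.1 (q.2 i) * φ q.1 (q.2 j)) :=
    Finset.measurable_fun_sum _ fun i _ => Finset.measurable_fun_sum _ fun j _ => hm2 i j
  rw [lintegral_const_mul' _ _ (by simp), lintegral_lintegral_swap hm1.aemeasurable,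
    lintegral_lintegral_swap (μ := ν) (ν := γ)
      (f := fun z x => ∑ i, ∑ j, φ z (x i) * φ z (x j)) hm3.aemeasurable] at main
  have e2 : ∀ x : Fin N → E,
      ∫⁻ z, ∑ i, ∑ j, φ z (x i) * φ z (x j) ∂ν = K * ∑ i, ∑ j, k (x i) (x j) := by
    intro x
    rw [lintegral_finsetSum _ fun i _ => Finset.measurable_fun_sum _ fun j _ => hm2' x i j,
      Finset.mul_sum]
    refine Finset.sum_congr rfl fun i _ => ?_
    rw [lintegral_finsetSum _ fun j _ => hm2' x i j, Finset.mul_sum]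
    exact Finset.sum_congr rfl fun j _ => hfac _ _
  simp_rw [hfac, e2] at main
  rw [lintegral_const_mul' _ _ hKt, lintegral_const_mul' _ _ hKt, mul_left_comm] at main
  exact (ENNReal.mul_le_mul_iff_right hK0 hKt).1 main

lemma gK_pos {d N : ℕ} (μ : Measure (EuclideanSpace ℝ (Fin d))) [IsProbabilityMeasure μ]
    (γ : Measure (Fin N → EuclideanSpace ℝ (Fin d))) [IsProbabilityMeasure γ]
    (hγ : ∀ i, γ.map (fun x => x i) = μ) (s : ℝ) :
    (N : ℝ≥0∞) ^ 2 * ∫⁻ p, gK s p.1 p.2 ∂(μ.prod μ) ≤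
      ∫⁻ x, ∑ i, ∑ j, gK s (x i) (x j) ∂γ := by
  rcases eq_or_ne s 0 with rfl | hs
  · simp [gK, pow_two]
  refine kernel_pos volume μ γ hγ
    (fun z x => ENNReal.ofReal (Real.exp (-(2 * s ^ 2) * ‖x - z‖ ^ 2))) ?_ (gK s) _
    (gauss_const (d := d) hs).1 (gauss_const (d := d) hs).2 (gK_factor s)
  apply ENNReal.measurable_ofReal.comp
  apply Continuous.measurable
  fun_prop

lemma sum_symm_split {N : ℕ} (f : Fin N → Fin N → ℝ≥0∞) (hf : ∀ i j, f i j = f j i) :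
    ∑ i, ∑ j, f i j = ∑ i, f i i + 2 * ∑ i, ∑ j ∈ Finset.Ioi i, f i j := by
  have h1 : ∀ i, ∑ j, f i j = f i i + ∑ j ∈ Finset.Ioi i, f i j + ∑ j ∈ Finset.Iio i, f i j := by
    intro i
    have e1 : ∑ j ∈ Finset.Ioi i, f i j = ∑ j, if i < j then f i j else 0 := by
      rw [← Finset.sum_filter]; congr 1; ext j; simp
    have e2 : ∑ j ∈ Finset.Iio i, f i j = ∑ j, if j < i then f i j else 0 := by
      rw [← Finset.sum_filter]; congr 1; ext j; simp
    have e3 : f i i = ∑ j, if j = i then f i j else 0 := by simp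
    rw [e1, e2, e3, ← Finset.sum_add_distrib, ← Finset.sum_add_distrib]
    refine Finset.sum_congr rfl fun j _ => ?_
    rcases lt_trichotomy i j with h | h | h
    · simp [h, h.ne', h.not_gt]
    · simp [h]
    · simp [h, h.ne, h.not_gt]
  have h2 : ∑ i, ∑ j ∈ Finset.Iio i, f i j = ∑ i, ∑ j ∈ Finset.Ioi i, f i j := by
    rw [Finset.sum_comm' (t' := Finset.univ) (s' := fun j => Finset.Ioi j) (by simp)]
    exact Finset.sum_congr rfl fun i _ => Finset.sum_congr rfl fun j _ => hf _ _
  simp_rw [h1, Finset.sum_add_distrib]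
  rw [h2, two_mul, add_assoc]

lemma lower_gamma {d N : ℕ} (μ : Measure (EuclideanSpace ℝ (Fin d))) [IsProbabilityMeasure μ]
    (γ : Measure (Fin N → EuclideanSpace ℝ (Fin d))) [IsProbabilityMeasure γ]
    (hγ : ∀ i, γ.map (fun x => x i) = μ) (S : Set ℝ) :
    (N : ℝ≥0∞) ^ 2 * ∫⁻ s in S, ∫⁻ p, gK s p.1 p.2 ∂(μ.prod μ) ≤
      N * volume S + 2 * (ENNReal.ofReal (√Real.pi) * ∫⁻ x, coulomb x ∂γ) := by
  have hm : ∀ i j, Measurable (fun q : ℝ × (Fin N → EuclideanSpace ℝ (Fin d)) =>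
      gK q.1 (q.2 i) (q.2 j)) := fun i j =>
    gK_meas.comp (f := fun q : ℝ × (Fin N → EuclideanSpace ℝ (Fin d)) =>
      (q.1, (q.2 i, q.2 j))) (by fun_prop)
  have hms : Measurable (fun q : ℝ × (Fin N → EuclideanSpace ℝ (Fin d)) =>
      ∑ i, ∑ j ∈ Finset.Ioi i, gK q.1 (q.2 i) (q.2 j)) :=
    Finset.measurable_fun_sum _ fun i _ => Finset.measurable_fun_sum _ fun j _ => hm i j
  have hm' : ∀ (x : Fin N → EuclideanSpace ℝ (Fin d)) i j,
      Measurable (fun s => gK s (x i) (x j)) := fun x i j => (hm i j).comp measurable_prodMk_right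
  have e1 : ∀ s, ∫⁻ x, ∑ i, ∑ j, gK s (x i) (x j) ∂γ =
      N + 2 * ∫⁻ x, ∑ i, ∑ j ∈ Finset.Ioi i, gK s (x i) (x j) ∂γ := by
    intro s
    have : ∀ x : Fin N → EuclideanSpace ℝ (Fin d), ∑ i, ∑ j, gK s (x i) (x j) =
      N + 2 * ∑ i, ∑ j ∈ Finset.Ioi i, gK s (x i) (x j) := by
      intro x
      rw [sum_symm_split _ fun i j => gK_symm s _ _]
      simp [gK_self]
    simp_rw [this]
    rw [lintegral_add_left measurable_const, lintegral_const_mul' _ _ (by simp)]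
    simp
  have e2 : ∀ x : Fin N → EuclideanSpace ℝ (Fin d),
      ∫⁻ s, ∑ i, ∑ j ∈ Finset.Ioi i, gK s (x i) (x j) =
        ENNReal.ofReal (√Real.pi) * coulomb x := by
    intro x
    unfold coulomb
    rw [lintegral_finsetSum _ fun i _ => Finset.measurable_fun_sum _ fun j _ => hm' x i j,
      Finset.mul_sum]
    refine Finset.sum_congr rfl fun i _ => ?_
    rw [lintegral_finsetSum _ fun j _ => hm' x i j, Finset.mul_sum]
    exact Finset.sum_congr rfl fun j _ => gK_lintegral _ _
  calc (N : ℝ≥0∞) ^ 2 * ∫⁻ s in S, ∫⁻ p, gK s p.1 p.2 ∂(μ.prod μ)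
      = ∫⁻ s in S, (N : ℝ≥0∞) ^ 2 * ∫⁻ p, gK s p.1 p.2 ∂(μ.prod μ) := by
        rw [lintegral_const_mul' _ _ (by simp)]
    _ ≤ ∫⁻ s in S, (N + 2 * ∫⁻ x, ∑ i, ∑ j ∈ Finset.Ioi i, gK s (x i) (x j) ∂γ) :=
        lintegral_mono fun s => (gK_pos μ γ hγ s).trans (e1 s).le
    _ = N * volume S + 2 * ∫⁻ s in S, ∫⁻ x, ∑ i, ∑ j ∈ Finset.Ioi i, gK s (x i) (x j) ∂γ := by
        rw [lintegral_add_left measurable_const, lintegral_const_mul' _ _ (by simp)]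
        simp
    _ ≤ N * volume S + 2 * ∫⁻ s, ∫⁻ x, ∑ i, ∑ j ∈ Finset.Ioi i, gK s (x i) (x j) ∂γ := by
        gcongr
        exact Measure.restrict_le_self
    _ = _ := by
        rw [lintegral_lintegral_swap hms.aemeasurable]
        simp_rw [e2]
        rw [lintegral_const_mul' _ _ (by simp)]

lemma coulomb_pi {d : ℕ} (N : ℕ) (μ : Measure (EuclideanSpace ℝ (Fin d)))
    [IsProbabilityMeasure μ] :
    ∫⁻ x, coulomb x ∂(Measure.pi fun _ : Fin N => μ) =
      (N.choose 2 : ℝ≥0∞) * ∫⁻ p, (ENNReal.ofReal ‖p.1 - p.2‖)⁻¹ ∂(μ.prod μ) := by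
  have hc : Measurable (fun p : EuclideanSpace ℝ (Fin d) × EuclideanSpace ℝ (Fin d) =>
      (ENNReal.ofReal ‖p.1 - p.2‖)⁻¹) := by fun_prop
  have hmap : ∀ i, (Measure.pi fun _ : Fin N => μ).map (fun x => x i) = μ := fun i =>
    (measurePreserving_eval (fun _ : Fin N => μ) i).map_eq
  have hpair : ∀ i j : Fin N, i ≠ j →
      ∫⁻ x, (ENNReal.ofReal ‖x i - x j‖)⁻¹ ∂(Measure.pi fun _ : Fin N => μ) =
      ∫⁻ p, (ENNReal.ofReal ‖p.1 - p.2‖)⁻¹ ∂(μ.prod μ) := by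
    intro i j hij
    have hI := (ProbabilityTheory.iIndepFun_pi (μ := fun _ : Fin N => μ)
      (X := fun _ : Fin N => (id : EuclideanSpace ℝ (Fin d) → EuclideanSpace ℝ (Fin d)))
      (fun _ => aemeasurable_id)).indepFun hij
    have h := (ProbabilityTheory.indepFun_iff_map_prod_eq_prod_map_map
      (measurable_pi_apply i).aemeasurable (measurable_pi_apply j).aemeasurable).1 hI
    simp only [id, hmap] at h
    rw [← h, lintegral_map hc (by fun_prop)]
  unfold coulomb
  rw [lintegral_finsetSum _ (by fun_prop)]
  have : ∀ i : Fin N, ∫⁻ x, ∑ j ∈ Finset.Ioi i, (ENNReal.ofReal ‖x i - x j‖)⁻¹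
      ∂(Measure.pi fun _ : Fin N => μ) = ((N - 1 - (i : ℕ) : ℕ) : ℝ≥0∞) *
        ∫⁻ p, (ENNReal.ofReal ‖p.1 - p.2‖)⁻¹ ∂(μ.prod μ) := by
    intro i
    rw [lintegral_finsetSum _ (by fun_prop), Finset.sum_congr rfl fun j hj =>
      hpair i j (Finset.mem_Ioi.1 hj).ne, Finset.sum_const, Fin.card_Ioi, nsmul_eq_mul]
  simp_rw [this]
  rw [← Finset.sum_mul]
  congr 1
  rw [← Nat.cast_sum, Fin.sum_univ_eq_sum_range (fun i => N - 1 - i),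
    Finset.sum_range_reflect (fun i => i), Finset.sum_range_id, Nat.choose_two_right]

theorem coulomb_many_particles_mean_field_limit {d : ℕ}
    (μ : Measure (EuclideanSpace ℝ (Fin d))) [IsProbabilityMeasure μ] :
    Filter.Tendsto (fun N : ℕ =>
        ((N.choose 2 : ℝ≥0∞))⁻¹ *
          sInf {r : ℝ≥0∞ | ∃ γ : Measure (Fin N → EuclideanSpace ℝ (Fin d)),
            IsProbabilityMeasure γ ∧ (∀ i, γ.map (fun x => x i) = μ) ∧
            r = ∫⁻ x, coulomb x ∂γ})
      Filter.atTop
      (nhds (∫⁻ p, (ENNReal.ofReal ‖p.1 - p.2‖)⁻¹ ∂(μ.prod μ))) := by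
  set P := ENNReal.ofReal (√Real.pi) with hP
  have hP0 : P ≠ 0 := by
    simpa [hP] using Real.pi_pos
  have hPt : P ≠ ∞ := ENNReal.ofReal_ne_top
  set E := ∫⁻ p, (ENNReal.ofReal ‖p.1 - p.2‖)⁻¹ ∂(μ.prod μ) with hE
  set G : ℕ → ℝ≥0∞ := fun n =>
    ∫⁻ s in Set.Icc (-(n : ℝ)) n, ∫⁻ p, gK s p.1 p.2 ∂(μ.prod μ) with hG
  have hsup : P * E = ⨆ n, G n := by
    rw [hG, ← setLIntegral_iUnion_of_directed]
    · have hU : (⋃ n : ℕ, Set.Icc (-(n : ℝ)) n) = Set.univ := by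
        ext s
        simp only [Set.mem_iUnion, Set.mem_Icc, Set.mem_univ, iff_true]
        obtain ⟨n, hn⟩ := exists_nat_ge |s|
        exact ⟨n, abs_le.1 hn⟩
      rw [hU, Measure.restrict_univ, lintegral_lintegral_swap gK_meas.aemeasurable]
      simp_rw [gK_lintegral]
      rw [lintegral_const_mul' _ _ hPt]
    · apply Monotone.directed_le
      intro m n hmn
      have : (m : ℝ) ≤ n := by exact_mod_cast hmn
      exact Set.Icc_subset_Icc (by linarith) this
  have hfin : ∀ n, G n ≠ ∞ := by
    intro n
    have : G n ≤ ∫⁻ s in Set.Icc (-(n : ℝ)) n, 1 := by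
      refine lintegral_mono fun s => ?_
      calc ∫⁻ p, gK s p.1 p.2 ∂(μ.prod μ) ≤ ∫⁻ p, 1 ∂(μ.prod μ) :=
            lintegral_mono fun p => gK_le_one _ _ _
        _ = 1 := by simp
    refine ne_top_of_le_ne_top ?_ this
    simp
  rw [tendsto_order]
  constructor
  · intro b hb
    have hb' : P * b < P * E := (ENNReal.mul_lt_mul_iff_right hP0 hPt).2 hb
    rw [hsup] at hb'
    obtain ⟨n, hn⟩ := lt_iSup_iff.1 hb'
    set V := volume (Set.Icc (-(n : ℝ)) n) with hV
    have hVt : V ≠ ∞ := by simp [hV]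
    have hlim : Filter.Tendsto (fun N : ℕ => G n - V * (N : ℝ≥0∞)⁻¹) Filter.atTop
        (nhds (G n - V * 0)) :=
      ENNReal.Tendsto.sub tendsto_const_nhds
        (ENNReal.Tendsto.const_mul ENNReal.tendsto_inv_nat_nhds_zero (Or.inr hVt))
        (Or.inl (hfin n))
    rw [mul_zero, tsub_zero] at hlim
    filter_upwards [(tendsto_order.1 hlim).1 _ hn, Filter.eventually_ge_atTop 2] with N hN hN2
    set M := sInf {r : ℝ≥0∞ | ∃ γ : Measure (Fin N → EuclideanSpace ℝ (Fin d)),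
            IsProbabilityMeasure γ ∧ (∀ i, γ.map (fun x => x i) = μ) ∧
            r = ∫⁻ x, coulomb x ∂γ} with hM
    have hN0 : (N : ℝ≥0∞) ≠ 0 := by simp; omega
    have hNt : (N : ℝ≥0∞) ≠ ∞ := by simp
    have hc0 : (N.choose 2 : ℝ≥0∞) ≠ 0 := by
      have := Nat.choose_pos hN2
      simpa using this.ne'
    have hct : (N.choose 2 : ℝ≥0∞) ≠ ∞ := by simp
    have hch : 2 * (N.choose 2 : ℝ≥0∞) ≤ (N : ℝ≥0∞) ^ 2 := by
      have : 2 * N.choose 2 ≤ N ^ 2 := by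
        rw [Nat.choose_two_right]
        calc 2 * (N * (N - 1) / 2) ≤ N * (N - 1) := Nat.mul_div_le _ _
          _ ≤ N ^ 2 := by rw [pow_two]; exact Nat.mul_le_mul_left _ (Nat.sub_le _ _)
      exact_mod_cast this
    -- bound for each competitor
    have hkey : b < (N.choose 2 : ℝ≥0∞)⁻¹ * M := by
      have hr : (N.choose 2 : ℝ≥0∞) * (P⁻¹ * (G n - V * (N : ℝ≥0∞)⁻¹)) ≤ M := by
        refine le_sInf ?_
        rintro r ⟨γ, hγp, hγ, rfl⟩
        have h := lower_gamma μ γ hγ (Set.Icc (-(n : ℝ)) n)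
        set I := ∫⁻ x, coulomb x ∂γ
        change (N : ℝ≥0∞) ^ 2 * G n ≤ N * V + 2 * (P * I) at h
        have h3 : (N : ℝ≥0∞) ^ 2 * (G n - V * (N : ℝ≥0∞)⁻¹) ≤ 2 * (P * I) := by
          rw [ENNReal.mul_sub (fun _ _ => by simp)]
          have : (N : ℝ≥0∞) ^ 2 * (V * (N : ℝ≥0∞)⁻¹) = N * V := by
            calc (N : ℝ≥0∞) ^ 2 * (V * (N : ℝ≥0∞)⁻¹)
                = N * V * (N * (N : ℝ≥0∞)⁻¹) := by ring
              _ = N * V := by rw [ENNReal.mul_inv_cancel hN0 hNt, mul_one]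
          rw [this]
          exact tsub_le_iff_left.2 h
        have h4 : 2 * ((N.choose 2 : ℝ≥0∞) * (G n - V * (N : ℝ≥0∞)⁻¹)) ≤ 2 * (P * I) := by
          rw [← mul_assoc]
          exact (mul_le_mul_left hch _).trans h3
        have h5 := (ENNReal.mul_le_mul_iff_right (by simp) (by simp)).1 h4
        rw [mul_left_comm]
        calc P⁻¹ * ((N.choose 2 : ℝ≥0∞) * (G n - V * (N : ℝ≥0∞)⁻¹)) ≤ P⁻¹ * (P * I) := by gcongr
          _ = I := by rw [← mul_assoc, ENNReal.inv_mul_cancel hP0 hPt, one_mul]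
      have h6 : b < P⁻¹ * (G n - V * (N : ℝ≥0∞)⁻¹) := by
        rw [← ENNReal.mul_lt_mul_iff_right hP0 hPt, ← mul_assoc, ENNReal.mul_inv_cancel hP0 hPt,
          one_mul]
        exact hN
      refine h6.trans_le ?_
      rw [← ENNReal.mul_le_mul_iff_right hc0 hct, ← mul_assoc (N.choose 2 : ℝ≥0∞) ((N.choose 2 : ℝ≥0∞)⁻¹),
        ENNReal.mul_inv_cancel hc0 hct, one_mul]
      exact hr
    exact hkey
  · intro b hb
    filter_upwards [Filter.eventually_ge_atTop 2] with N hN2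
    have hc0 : (N.choose 2 : ℝ≥0∞) ≠ 0 := by
      have := Nat.choose_pos hN2
      simpa using this.ne'
    have hct : (N.choose 2 : ℝ≥0∞) ≠ ∞ := by simp
    refine lt_of_le_of_lt ?_ hb
    calc _ ≤ (N.choose 2 : ℝ≥0∞)⁻¹ * ((N.choose 2 : ℝ≥0∞) * E) := by
          gcongr
          refine sInf_le ⟨Measure.pi fun _ => μ, inferInstance, fun i => ?_, ?_⟩
          · exact (measurePreserving_eval (fun _ : Fin N => μ) i).map_eq
          · exact (coulomb_pi N μ).symm
      _ = E := by rw [← mul_assoc, ENNReal.inv_mul_cancel hc0 hct, one_mul]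
end
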